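/- arXiv:2206.03724 — 2 statements merged into one kernel-verified Lean document; each statement's English description precedes it below -/
import Mathlib

section
/- For each j ∈ ℤ let V_{j,k} denote the closed linear span in L²(ℝ^d; ℂ) of {w_{n, R_{j,k}} : n ∈ ℕ₀^d} for k ∈ E, and let W_j denote the closed linear span of the tensor-product brushlets { x ↦ ∏_{i=1}^d w_{m_i, I_j^i}(x_i) : m ∈ ℕ₀^d }, where I_j^i := [−2^{j a_i}, 2^{j a_i}) carries cutoff radii 2^{(j−2)a_i} at both endpoints. Then for every j ∈ ℤ: the subspaces {V_{j,k}}_{k∈E} are pairwise orthogonal and each is orthogonal to W_{j−1}; W_{j−1} ⊆ W_j; and W_j = W_{j−1} ⊕ (⊕_{k∈E} V_{j,k}) as an orthogonal direct sum of closed subspaces. -/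
open MeasureTheory

/-- The bell function `b_I(ξ) = ρ((ξ − α)/ε) ρ((α' − ξ)/ε')`. -/
noncomputable def bellFn (ρ : ℝ → ℝ) (α α' ε ε' : ℝ) (ξ : ℝ) : ℝ :=
  ρ ((ξ - α) / ε) * ρ ((α' - ξ) / ε')

/-- Pointwise inverse Fourier transform, for the normalization
`(𝓕 f)(ξ) = (2π)^{-1/2} ∫ f(x) e^{-ixξ} dx`. -/
noncomputable def invFourier (g : ℝ → ℂ) (x : ℝ) : ℂ :=
  ((Real.sqrt (2 * Real.pi))⁻¹ : ℂ) * ∫ ξ : ℝ, g ξ * Complex.exp (Complex.I * x * ξ)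

/-- Frequency side of the brushlet `w_{n,I}`. -/
noncomputable def brushletHat (ρ : ℝ → ℝ) (α α' ε ε' : ℝ) (n : ℕ) (ξ : ℝ) : ℝ :=
  Real.sqrt (2 / (α' - α)) * bellFn ρ α α' ε ε' ξ *
    Real.cos (Real.pi * ((n : ℝ) + 1 / 2) * (ξ - α) / (α' - α))

/-- The brushlet `w_{n,I}` (continuous representative). -/
noncomputable def brushlet (ρ : ℝ → ℝ) (α α' ε ε' : ℝ) (n : ℕ) (x : ℝ) : ℂ :=
  invFourier (fun ξ => (brushletHat ρ α α' ε ε' n ξ : ℂ)) x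

/-- Left endpoint of the interval `I^i_{j,k}` of the anisotropic Lizorkin partition. -/
noncomputable def lizL (ai : ℝ) (j : ℤ) (k : ℤ) : ℝ :=
  if k = 1 then 0
  else if k = -1 then -((2 : ℝ) ^ (((j : ℝ) - 1) * ai))
  else if k = 2 then (2 : ℝ) ^ (((j : ℝ) - 1) * ai)
  else -((2 : ℝ) ^ ((j : ℝ) * ai))

/-- Right endpoint of the interval `I^i_{j,k}`. -/
noncomputable def lizR (ai : ℝ) (j : ℤ) (k : ℤ) : ℝ :=
  if k = 1 then (2 : ℝ) ^ (((j : ℝ) - 1) * ai)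
  else if k = -1 then 0
  else if k = 2 then (2 : ℝ) ^ ((j : ℝ) * ai)
  else -((2 : ℝ) ^ (((j : ℝ) - 1) * ai))

/-- Cutoff radius at the left endpoint of `I^i_{j,k}`. -/
noncomputable def lizEpsL (ai : ℝ) (j : ℤ) (k : ℤ) : ℝ :=
  if k = -2 then (2 : ℝ) ^ (((j : ℝ) - 2) * ai) else (2 : ℝ) ^ (((j : ℝ) - 3) * ai)

/-- Cutoff radius at the right endpoint of `I^i_{j,k}`. -/
noncomputable def lizEpsR (ai : ℝ) (j : ℤ) (k : ℤ) : ℝ :=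
  if k = 2 then (2 : ℝ) ^ (((j : ℝ) - 2) * ai) else (2 : ℝ) ^ (((j : ℝ) - 3) * ai)

/-- The multivariate tensor-product brushlet `w_{n, R_{j,k}}`. -/
noncomputable def mBrushlet (d : ℕ) (ρ : ℝ → ℝ) (a : Fin d → ℝ) (j : ℤ)
    (k : Fin d → ℤ) (n : Fin d → ℕ) (x : EuclideanSpace ℝ (Fin d)) : ℂ :=
  ∏ i, brushlet ρ (lizL (a i) j (k i)) (lizR (a i) j (k i))
    (lizEpsL (a i) j (k i)) (lizEpsR (a i) j (k i)) (n i) (x i)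

/-- The tensor-product brushlet of the big rectangle `∏ᵢ [−2^{j aᵢ}, 2^{j aᵢ})`, where
each interval `I_j^i = [−2^{j aᵢ}, 2^{j aᵢ})` carries cutoff radii `2^{(j−2)aᵢ}` at both
endpoints. -/
noncomputable def mBrushletBig (d : ℕ) (ρ : ℝ → ℝ) (a : Fin d → ℝ) (j : ℤ)
    (m : Fin d → ℕ) (x : EuclideanSpace ℝ (Fin d)) : ℂ :=
  ∏ i, brushlet ρ (-((2 : ℝ) ^ ((j : ℝ) * a i))) ((2 : ℝ) ^ ((j : ℝ) * a i))
    ((2 : ℝ) ^ (((j : ℝ) - 2) * a i)) ((2 : ℝ) ^ (((j : ℝ) - 2) * a i)) (m i) (x i)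

/-- The index set `E = E₂^d ∖ E₁^d` with `E₂ = {±1, ±2}`, `E₁ = {±1}`. -/
def idxE (d : ℕ) : Set (Fin d → ℤ) :=
  {k | (∀ i, k i = 1 ∨ k i = -1 ∨ k i = 2 ∨ k i = -2) ∧ ¬ (∀ i, k i = 1 ∨ k i = -1)}



lemma cosc_moment (α β : ℝ) (F : ℝ → ℂ) (hF : IntegrableOn F (Set.Ioo α β))
    (h : ∀ n : ℕ, ∫ ξ in Set.Ioo α β, F ξ *
      ((Real.cos (Real.pi * ((n : ℝ) + 1 / 2) * (ξ - α) / (β - α)) : ℝ) : ℂ) = 0) (m : ℕ) :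
    ∀ n : ℕ, ∫ ξ in Set.Ioo α β, F ξ *
      ((Real.cos (Real.pi * ((n : ℝ) + 1 / 2) * (ξ - α) / (β - α)) *
        Real.cos (Real.pi * (ξ - α) / (β - α)) ^ m : ℝ) : ℂ) = 0 := by
  have hint : ∀ φ : ℝ → ℝ, Continuous φ → (∃ C, ∀ x, |φ x| ≤ C) →
      IntegrableOn (fun ξ => F ξ * ((φ ξ : ℝ) : ℂ)) (Set.Ioo α β) := by
    intro φ hφ ⟨C, hC⟩
    refine Integrable.mul_bdd (c := C) hF (by fun_prop) ?_
    filter_upwards with x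
    simpa using hC x
  have hbd : ∀ (n m : ℕ) (x : ℝ), |Real.cos (Real.pi * ((n : ℝ) + 1 / 2) * (x - α) / (β - α)) *
        Real.cos (Real.pi * (x - α) / (β - α)) ^ m| ≤ 1 := by
    intro n m x
    rw [abs_mul, abs_pow]
    exact mul_le_one₀ (Real.abs_cos_le_one _) (by positivity)
      (pow_le_one₀ (abs_nonneg _) (Real.abs_cos_le_one _))
  induction m with
  | zero => intro n; simpa using h n
  | succ m ih =>
    intro n
    have key : ∀ n' : ℕ, (∀ x : ℝ, Real.cos (Real.pi * ((n : ℝ) + 1 / 2) * x) * Real.cos (Real.pi * x)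
        = (Real.cos (Real.pi * (((n + 1 : ℕ) : ℝ) + 1 / 2) * x) +
          Real.cos (Real.pi * ((n' : ℝ) + 1 / 2) * x)) / 2) →
        ∫ ξ in Set.Ioo α β, F ξ *
      ((Real.cos (Real.pi * ((n : ℝ) + 1 / 2) * (ξ - α) / (β - α)) *
        Real.cos (Real.pi * (ξ - α) / (β - α)) ^ (m + 1) : ℝ) : ℂ) = 0 := by
      intro n' hn'
      have e : ∀ ξ, F ξ * ((Real.cos (Real.pi * ((n : ℝ) + 1 / 2) * (ξ - α) / (β - α)) *
        Real.cos (Real.pi * (ξ - α) / (β - α)) ^ (m + 1) : ℝ) : ℂ) =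
        (1 / 2 : ℂ) * (F ξ * ((Real.cos (Real.pi * (((n + 1 : ℕ) : ℝ) + 1 / 2) * (ξ - α) / (β - α)) *
        Real.cos (Real.pi * (ξ - α) / (β - α)) ^ m : ℝ) : ℂ)) +
        (1 / 2 : ℂ) * (F ξ * ((Real.cos (Real.pi * ((n' : ℝ) + 1 / 2) * (ξ - α) / (β - α)) *
        Real.cos (Real.pi * (ξ - α) / (β - α)) ^ m : ℝ) : ℂ)) := by
        intro ξ
        have := hn' ((ξ - α) / (β - α))
        simp only [← mul_div_assoc] at this
        rw [pow_succ', ← mul_assoc, this]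
        push_cast
        ring
      simp_rw [e]
      rw [integral_add, integral_const_mul, integral_const_mul, ih, ih]
      · simp
      · exact (hint _ (by fun_prop) ⟨1, hbd _ _⟩).const_mul _
      · exact (hint _ (by fun_prop) ⟨1, hbd _ _⟩).const_mul _
    rcases n with _ | n
    · apply key 0
      intro x
      have h1 : Real.pi * (((0 + 1 : ℕ) : ℝ) + 1 / 2) * x
        = Real.pi * (((0 : ℕ) : ℝ) + 1 / 2) * x + Real.pi * x := by push_cast; ring
      have h2 : Real.cos (Real.pi * (((0 : ℕ) : ℝ) + 1 / 2) * x)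
        = Real.cos (Real.pi * (((0 : ℕ) : ℝ) + 1 / 2) * x - Real.pi * x) := by
        rw [← Real.cos_neg]; congr 1; push_cast; ring
      rw [Real.cos_sub] at h2
      rw [h1, Real.cos_add]
      linarith
    · apply key n
      intro x
      have h1 : Real.pi * (((n + 1 + 1 : ℕ) : ℝ) + 1 / 2) * x
        = Real.pi * (((n + 1 : ℕ) : ℝ) + 1 / 2) * x + Real.pi * x := by push_cast; ring
      have h2 : Real.pi * ((n : ℝ) + 1 / 2) * x
        = Real.pi * (((n + 1 : ℕ) : ℝ) + 1 / 2) * x - Real.pi * x := by push_cast; ring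
      rw [h1, h2, Real.cos_add, Real.cos_sub]; ring

lemma cosc_complete (α β : ℝ) (hab : α < β) (F : ℝ → ℂ) (hF : IntegrableOn F (Set.Ioo α β))
    (h : ∀ n : ℕ, ∫ ξ in Set.Ioo α β, F ξ *
      ((Real.cos (Real.pi * ((n : ℝ) + 1 / 2) * (ξ - α) / (β - α)) : ℝ) : ℂ) = 0) :
    ∀ᵐ ξ, ξ ∈ Set.Ioo α β → F ξ = 0 := by
  have hba : 0 < β - α := sub_pos.2 hab
  set H : ℝ → ℝ := fun ξ => Real.cos (Real.pi * (((0 : ℕ) : ℝ) + 1 / 2) * (ξ - α) / (β - α)) with hH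
  set c : ℝ → ℝ := fun ξ => Real.cos (Real.pi * (ξ - α) / (β - α)) with hc
  set G : ℝ → ℂ := fun ξ => F ξ * (H ξ : ℂ) with hG
  have hcc : Continuous c := by fun_prop
  have hHc : Continuous H := by fun_prop
  have hGi : IntegrableOn G (Set.Ioo α β) := by
    refine Integrable.mul_bdd (c := 1) hF (by fun_prop) ?_
    filter_upwards with x
    simpa using Real.abs_cos_le_one _
  have hbd : ∀ φ : ℝ → ℝ, ContinuousOn φ (Set.Icc α β) → 
      IntegrableOn (fun ξ => G ξ * ((φ ξ : ℝ) : ℂ)) (Set.Ioo α β) := by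
    intro φ hφ
    obtain ⟨C, hC⟩ := isCompact_Icc.exists_bound_of_continuousOn hφ
    refine Integrable.mul_bdd (c := C) hGi ?_ ?_
    · have := (hφ.mono Set.Ioo_subset_Icc_self).aestronglyMeasurable (μ := volume) measurableSet_Ioo
      exact Complex.continuous_ofReal.comp_aestronglyMeasurable this
    · filter_upwards [ae_restrict_mem measurableSet_Ioo] with x hx
      simpa using hC x (Set.Ioo_subset_Icc_self hx)
  have hmom : ∀ m : ℕ, ∫ ξ in Set.Ioo α β, G ξ * ((c ξ ^ m : ℝ) : ℂ) = 0 := by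
    intro m
    have := cosc_moment α β F hF h m 0
    rw [← this]
    congr 1; ext ξ
    simp only [hG, hH, hc]
    push_cast; ring
  have hpoly : ∀ P : Polynomial ℝ, ∫ ξ in Set.Ioo α β, G ξ * ((P.eval (c ξ) : ℝ) : ℂ) = 0 := by
    intro P
    induction P using Polynomial.induction_on' with
    | add p q hp hq =>
      simp only [Polynomial.eval_add, Complex.ofReal_add, mul_add]
      rw [integral_add, hp, hq, add_zero]
      · exact hbd _ (by fun_prop)
      · exact hbd _ (by fun_prop)
    | monomial n r =>
      have := hmom n
      simp only [Polynomial.eval_monomial, Complex.ofReal_mul]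
      simp_rw [mul_left_comm _ (r : ℂ)]
      rw [integral_const_mul, this, mul_zero]
  let cX : C(Set.Icc α β, ℝ) := ⟨fun x => c x, by fun_prop⟩
  have hsep : (Algebra.adjoin ℝ {cX}).SeparatesPoints := by
    intro x y hxy
    refine ⟨cX, ⟨cX, Algebra.subset_adjoin rfl, rfl⟩, ?_⟩
    intro heq
    apply hxy
    have hx := x.2
    have hy := y.2
    have hm : ∀ z : Set.Icc α β, Real.pi * (z.1 - α) / (β - α) ∈ Set.Icc 0 Real.pi := by
      intro z
      have h1 := z.2.1
      have h2 := z.2.2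
      have hp := Real.pi_pos
      constructor
      · apply div_nonneg (mul_nonneg hp.le (by linarith)) hba.le
      · rw [div_le_iff₀ hba]; exact mul_le_mul_of_nonneg_left (by linarith) hp.le
    have := Real.injOn_cos (hm x) (hm y) heq
    rw [div_left_inj' hba.ne', mul_right_inj' Real.pi_pos.ne'] at this
    exact Subtype.ext (by linarith)
  have hall : ∀ g : ℝ → ℝ, Continuous g → ∫ ξ in Set.Ioo α β, G ξ * ((g ξ : ℝ) : ℂ) = 0 := by
    intro g hg
    let gX : C(Set.Icc α β, ℝ) := ⟨fun x => g x, by fun_prop⟩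
    set M := ∫ ξ in Set.Ioo α β, ‖G ξ‖ with hM
    have hM0 : 0 ≤ M := integral_nonneg fun _ => norm_nonneg _
    rw [← norm_le_zero_iff]
    apply le_of_forall_pos_le_add
    intro e he
    obtain ⟨p, hp⟩ := ContinuousMap.exists_mem_subalgebra_near_continuousMap_of_separatesPoints
      (Algebra.adjoin ℝ {cX}) hsep gX (e / (M + 1)) (by positivity)
    obtain ⟨p, hpA⟩ := p
    rw [Algebra.adjoin_singleton_eq_range_aeval] at hpA
    obtain ⟨P, rfl⟩ := hpA
    have hval : ∀ x : Set.Icc α β, (Polynomial.aeval cX P) x = P.eval (c x) := by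
      intro x
      rw [Polynomial.aeval_continuousMap_apply]
      rfl
    have hdiff : ∫ ξ in Set.Ioo α β, G ξ * ((g ξ : ℝ) : ℂ) =
        ∫ ξ in Set.Ioo α β, G ξ * ((g ξ - P.eval (c ξ) : ℝ) : ℂ) := by
      simp only [Complex.ofReal_sub, mul_sub]
      rw [integral_sub, hpoly P, sub_zero]
      · exact hbd _ (by fun_prop)
      · exact hbd _ (by fun_prop)
    rw [hdiff, zero_add]
    calc _ ≤ ∫ ξ in Set.Ioo α β, ‖G ξ‖ * (e / (M + 1)) := by
          apply norm_integral_le_of_norm_le (hGi.norm.mul_const _)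
          filter_upwards [ae_restrict_mem measurableSet_Ioo] with x hx
          rw [norm_mul]
          gcongr
          have hx' := Set.Ioo_subset_Icc_self hx
          have h1 := (ContinuousMap.norm_coe_le_norm (Polynomial.aeval cX P - gX) ⟨x, hx'⟩).trans hp.le
          rw [ContinuousMap.sub_apply, hval, norm_sub_rev] at h1
          rw [Complex.norm_real]
          exact h1
      _ = M * (e / (M + 1)) := by rw [integral_mul_const]
      _ ≤ e := by
          rw [mul_div_assoc', div_le_iff₀ (by positivity)]; nlinarith
  have hG0 : ∀ᵐ ξ, ξ ∈ Set.Ioo α β → G ξ = 0 := by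
    apply isOpen_Ioo.ae_eq_zero_of_integral_contDiff_smul_eq_zero hGi.locallyIntegrableOn
    intro g hg _ hsupp
    rw [← hall g hg.continuous, ← integral_indicator measurableSet_Ioo]
    congr 1; ext x
    by_cases hx : x ∈ Set.Ioo α β
    · simp [hx, mul_comm]
    · have : g x = 0 := image_eq_zero_of_notMem_tsupport (fun hh => hx (hsupp hh))
      simp [hx, this]
  filter_upwards [hG0] with x hx hxI
  have h0 := hx hxI
  have hp := Real.pi_pos
  have hHx : 0 < H x := by
    apply Real.cos_pos_of_mem_Ioo
    have h1 : 0 < (x - α) / (β - α) := div_pos (by linarith [hxI.1]) hba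
    have h2 : (x - α) / (β - α) < 1 := by rw [div_lt_one hba]; linarith [hxI.2]
    rw [mul_div_assoc]
    constructor <;> push_cast <;> nlinarith
  have : (H x : ℂ) ≠ 0 := by exact_mod_cast hHx.ne'
  simpa [hG, this] using h0
structure IsRamp (ρ : ℝ → ℝ) : Prop where
  smooth : ∀ m : ℕ, ContDiff ℝ m ρ
  nonneg : ∀ ξ, 0 ≤ ρ ξ
  le_one : ∀ ξ, ρ ξ ≤ 1
  neg : ∀ ξ, ξ ≤ -1 → ρ ξ = 0
  pos : ∀ ξ, 1 ≤ ξ → ρ ξ = 1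
  sq : ∀ ξ, ρ ξ ^ 2 + ρ (-ξ) ^ 2 = 1

lemma IsRamp.cont {ρ : ℝ → ℝ} (h : IsRamp ρ) : Continuous ρ := (h.smooth 0).continuous

lemma IsRamp.zero_of_le {ρ : ℝ → ℝ} (h : IsRamp ρ) {x e : ℝ} (he : 0 < e) (hx : x ≤ -e) :
    ρ (x / e) = 0 := h.neg _ (by rw [div_le_iff₀ he]; linarith)

lemma IsRamp.one_of_le {ρ : ℝ → ℝ} (h : IsRamp ρ) {x e : ℝ} (he : 0 < e) (hx : e ≤ x) :
    ρ (x / e) = 1 := h.pos _ (by rw [le_div_iff₀ he]; linarith)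

lemma integral_fold (α β : ℝ) (hab : α < β) (G : ℝ → ℂ) (hGi : Integrable G)
    (h1 : ∀ ξ, ξ ≤ α - (β - α) → G ξ = 0) (h2 : ∀ ξ, β + (β - α) ≤ ξ → G ξ = 0)
    (φ : ℝ → ℝ) (hφ : Continuous φ) (hb : ∀ x, |φ x| ≤ 1)
    (he : ∀ x, φ (2 * α - x) = φ x) (ho : ∀ x, φ (2 * β - x) = - φ x) :
    ∫ ξ, G ξ * (φ ξ : ℂ) = ∫ ξ in Set.Ioo α β, (G ξ + G (2 * α - ξ) - G (2 * β - ξ)) * (φ ξ : ℂ) := by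
  set K : ℝ → ℂ := fun ξ => G ξ * (φ ξ : ℂ) with hK
  have hKi : Integrable K := by
    refine Integrable.mul_bdd (c := 1) hGi (by fun_prop) ?_
    filter_upwards with x
    simpa using hb x
  have hKα : Integrable (fun ξ => K (2 * α - ξ)) := hKi.comp_sub_left _
  have hKβ : Integrable (fun ξ => K (2 * β - ξ)) := hKi.comp_sub_left _
  have e0 : ∫ ξ, K ξ = (∫ ξ in Set.Ioo α β, K ξ) + (∫ ξ in Set.Iic α, K ξ) +
      ∫ ξ in Set.Ici β, K ξ := by
    rw [← integral_indicator measurableSet_Ioo, ← integral_indicator measurableSet_Iic,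
      ← integral_indicator measurableSet_Ici, ← integral_add, ← integral_add]
    · congr 1; ext x
      rcases le_or_gt x α with hx | hx
      · have : ¬ (β ≤ x) := by linarith
        simp [hx, this, Set.indicator, hx.not_gt]
      · rcases le_or_gt β x with hx' | hx'
        · simp [hx', hx, Set.indicator, hx'.not_gt]
        · simp [hx', hx, Set.indicator, hx.not_ge, hx'.not_ge]
    · exact (hKi.indicator measurableSet_Ioo).add (hKi.indicator measurableSet_Iic)
    · exact hKi.indicator measurableSet_Ici
    · exact hKi.indicator measurableSet_Ioo
    · exact hKi.indicator measurableSet_Iic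
  have hne : ∀ c : ℝ, ∀ᵐ x : ℝ, x ≠ c := fun c => by
    simp [ae_iff, measure_singleton]
  have e1 : ∫ ξ in Set.Iic α, K ξ = ∫ ξ in Set.Ioo α β, K (2 * α - ξ) := by
    rw [← integral_indicator measurableSet_Iic, ← integral_sub_left_eq_self _ _ (2 * α),
      ← integral_indicator measurableSet_Ioo]
    apply integral_congr_ae
    filter_upwards [hne α] with x hx
    by_cases hx1 : x < α
    · have : ¬ (2 * α - x ≤ α) := by linarith
      simp [Set.indicator, this, hx1.not_gt]
    · have hx2 : α < x := lt_of_le_of_ne (not_lt.1 hx1) (Ne.symm hx)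
      have : 2 * α - x ≤ α := by linarith
      by_cases hx3 : x < β
      · simp [Set.indicator, this, hx2, hx3]
      · have : K (2 * α - x) = 0 := by simp [hK, h1 (2 * α - x) (by linarith)]
        simp [Set.indicator, this]
  have e2 : ∫ ξ in Set.Ici β, K ξ = ∫ ξ in Set.Ioo α β, K (2 * β - ξ) := by
    rw [← integral_indicator measurableSet_Ici, ← integral_sub_left_eq_self _ _ (2 * β),
      ← integral_indicator measurableSet_Ioo]
    apply integral_congr_ae
    filter_upwards [hne β] with x hx
    by_cases hx1 : β < x
    · have : ¬ (β ≤ 2 * β - x) := by linarith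
      simp [Set.indicator, this, hx1.not_gt]
    · have hx2 : x < β := lt_of_le_of_ne (not_lt.1 hx1) hx
      have : β ≤ 2 * β - x := by linarith
      by_cases hx3 : α < x
      · simp [Set.indicator, this, hx2, hx3]
      · have : K (2 * β - x) = 0 := by simp [hK, h2 (2 * β - x) (by linarith)]
        simp [Set.indicator, this]
  rw [e0, e1, e2, ← integral_add hKi.integrableOn hKα.integrableOn,
    ← integral_add (f := fun ξ => K ξ + K (2 * α - ξ)) (hKi.add hKα).integrableOn hKβ.integrableOn]
  congr 1; ext x
  simp only [hK, he, ho]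
  push_cast; ring

noncomputable def foldF (ρ : ℝ → ℝ) (α β e e' : ℝ) (h : ℝ → ℂ) (ξ : ℝ) : ℂ :=
  (bellFn ρ α β e e' ξ : ℂ) * h ξ + (bellFn ρ α β e e' (2 * α - ξ) : ℂ) * h (2 * α - ξ)
    - (bellFn ρ α β e e' (2 * β - ξ) : ℂ) * h (2 * β - ξ)

lemma bell_zero_left {ρ : ℝ → ℝ} (hρ : IsRamp ρ) {α β e e' : ℝ} (he : 0 < e) {ξ : ℝ}
    (h : ξ ≤ α - e) : bellFn ρ α β e e' ξ = 0 := by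
  rw [bellFn, hρ.zero_of_le he (by linarith), zero_mul]

lemma bell_zero_right {ρ : ℝ → ℝ} (hρ : IsRamp ρ) {α β e e' : ℝ} (he : 0 < e') {ξ : ℝ}
    (h : β + e' ≤ ξ) : bellFn ρ α β e e' ξ = 0 := by
  rw [bellFn, hρ.zero_of_le he (by linarith), mul_zero]

lemma bell_contDiff {ρ : ℝ → ℝ} (hρ : IsRamp ρ) (α β e e' : ℝ) (m : ℕ) :
    ContDiff ℝ m (bellFn ρ α β e e') := by
  have := hρ.smooth m
  unfold bellFn
  fun_prop

lemma bell_cont {ρ : ℝ → ℝ} (hρ : IsRamp ρ) (α β e e' : ℝ) :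
    Continuous (bellFn ρ α β e e') := (bell_contDiff hρ α β e e' 0).continuous

lemma bell_cpt {ρ : ℝ → ℝ} (hρ : IsRamp ρ) {α β e e' : ℝ} (he : 0 < e) (he' : 0 < e') :
    HasCompactSupport (bellFn ρ α β e e') := by
  apply HasCompactSupport.intro (isCompact_Icc (a := α - e) (b := β + e'))
  intro x hx
  by_cases h : x ≤ α - e
  · exact bell_zero_left hρ he h
  · apply bell_zero_right hρ he'
    by_contra h'
    exact hx ⟨by linarith, by linarith⟩

lemma fold_iff {ρ : ℝ → ℝ} (hρ : IsRamp ρ) {α β e e' : ℝ} (he : 0 < e) (he' : 0 < e')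
    (hab : e + e' ≤ β - α) (h : ℝ → ℂ) (hh : MemLp h 2 volume) :
    (∀ n, ∫ ξ, (brushletHat ρ α β e e' n ξ : ℂ) * h ξ = 0) ↔
      ∀ᵐ ξ, ξ ∈ Set.Ioo α β → foldF ρ α β e e' h ξ = 0 := by
  have hba : 0 < β - α := by linarith
  set G : ℝ → ℂ := fun ξ => (bellFn ρ α β e e' ξ : ℂ) * h ξ with hG
  have hGi : Integrable G := by
    have hb : MemLp (fun ξ => (bellFn ρ α β e e' ξ : ℂ)) 2 volume := by
      apply Continuous.memLp_of_hasCompactSupport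
      · exact Complex.continuous_ofReal.comp (bell_cont hρ _ _ _ _)
      · exact (bell_cpt hρ he he').comp_left (g := fun x : ℝ => (x : ℂ)) (by simp)
    exact hb.integrable_mul hh
  have hs : Real.sqrt (2 / (β - α)) ≠ 0 := (Real.sqrt_pos.2 (by positivity)).ne'
  have hs' : (Real.sqrt (2 / (β - α)) : ℂ) ≠ 0 := by exact_mod_cast hs
  have key : ∀ n : ℕ, ∫ ξ, (brushletHat ρ α β e e' n ξ : ℂ) * h ξ =
      (Real.sqrt (2 / (β - α)) : ℂ) * ∫ ξ in Set.Ioo α β, foldF ρ α β e e' h ξ *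
        ((Real.cos (Real.pi * ((n : ℝ) + 1 / 2) * (ξ - α) / (β - α)) : ℝ) : ℂ) := by
    intro n
    have := integral_fold α β (by linarith) G hGi
      (fun ξ hξ => by simp [hG, bell_zero_left hρ (β := β) (e' := e') he (show ξ ≤ α - e by linarith)])
      (fun ξ hξ => by simp [hG, bell_zero_right hρ (α := α) (e := e) he' (show β + e' ≤ ξ by linarith)])
      (fun ξ => Real.cos (Real.pi * ((n : ℝ) + 1 / 2) * (ξ - α) / (β - α))) (by fun_prop)
      (fun x => Real.abs_cos_le_one _)
      (fun x => by rw [← Real.cos_neg]; congr 1; ring)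
      (fun x => by
        have : Real.pi * ((n : ℝ) + 1 / 2) * (2 * β - x - α) / (β - α) =
          Real.pi - Real.pi * ((n : ℝ) + 1 / 2) * (x - α) / (β - α) + n * (2 * Real.pi) := by
          field_simp; ring
        rw [this, Real.cos_add_nat_mul_two_pi, Real.cos_pi_sub])
    rw [← integral_const_mul] 
    simp only [hG] at this
    simp only [foldF]
    rw [integral_const_mul, ← this, ← integral_const_mul]
    congr 1; ext ξ
    simp only [brushletHat]
    push_cast; ring
  constructor
  · intro H
    apply cosc_complete α β (by linarith)
    · exact ((hGi.add (hGi.comp_sub_left (2 * α))).sub (hGi.comp_sub_left (2 * β))).integrableOn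
    · intro n
      have := H n
      rw [key] at this
      exact (mul_eq_zero.1 this).resolve_left hs'
  · intro H n
    rw [key, integral_eq_zero_of_ae, mul_zero]
    rw [Filter.EventuallyEq, ae_restrict_iff' measurableSet_Ioo]
    filter_upwards [H] with x hx hxI
    simp [hx hxI]

lemma fold_split {ρ : ℝ → ℝ} (hρ : IsRamp ρ) {α β γ e1 e2 e3 : ℝ} (h1 : 0 < e1) (h2 : 0 < e2)
    (h3 : 0 < e3) (hab : e1 + e2 ≤ β - α) (hbc : e2 + e3 ≤ γ - β) (h : ℝ → ℂ) :
    (∀ᵐ ξ, ξ ∈ Set.Ioo α γ → foldF ρ α γ e1 e3 h ξ = 0) ↔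
    ((∀ᵐ ξ, ξ ∈ Set.Ioo α β → foldF ρ α β e1 e2 h ξ = 0) ∧
     (∀ᵐ ξ, ξ ∈ Set.Ioo β γ → foldF ρ β γ e2 e3 h ξ = 0)) := by
  have hqmp : Measure.QuasiMeasurePreserving (fun x : ℝ => 2 * β - x) volume volume :=
    quasiMeasurePreserving_sub_left_of_right_invariant volume (2 * β)
  have Z := fun (x e : ℝ) (he : 0 < e) (hx : x ≤ -e) => hρ.zero_of_le he hx
  have O := fun (x e : ℝ) (he : 0 < e) (hx : e ≤ x) => hρ.one_of_le he hx
  -- far left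
  have L1 : ∀ ξ ∈ Set.Ioo α β, ξ ≤ β - e2 → foldF ρ α β e1 e2 h ξ = foldF ρ α γ e1 e3 h ξ := by
    intro ξ hξ hx
    obtain ⟨ha, hb⟩ := hξ
    simp only [foldF, bellFn]
    rw [O (β - ξ) e2 h2 (by linarith), O (γ - ξ) e3 h3 (by linarith),
      O (β - (2 * α - ξ)) e2 h2 (by linarith), O (γ - (2 * α - ξ)) e3 h3 (by linarith),
      Z (β - (2 * β - ξ)) e2 h2 (by linarith), Z (γ - (2 * γ - ξ)) e3 h3 (by linarith)]
    simp
  have L2 : ∀ ξ ∈ Set.Ioo α β, β - e2 < ξ → foldF ρ α β e1 e2 h ξ =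
      (ρ ((β - ξ) / e2) : ℂ) * h ξ - (ρ ((ξ - β) / e2) : ℂ) * h (2 * β - ξ) := by
    intro ξ hξ hx
    obtain ⟨ha, hb⟩ := hξ
    simp only [foldF, bellFn]
    rw [O (ξ - α) e1 h1 (by linarith), Z (2 * α - ξ - α) e1 h1 (by linarith),
      O (2 * β - ξ - α) e1 h1 (by linarith)]
    have : β - (2 * β - ξ) = ξ - β := by ring
    rw [this]; simp
  have C0 : ∀ ξ, β - e2 < ξ → ξ < β + e2 → foldF ρ α γ e1 e3 h ξ = h ξ := by
    intro ξ ha hb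
    simp only [foldF, bellFn]
    rw [O (ξ - α) e1 h1 (by linarith), O (γ - ξ) e3 h3 (by linarith),
      Z (2 * α - ξ - α) e1 h1 (by linarith), Z (γ - (2 * γ - ξ)) e3 h3 (by linarith)]
    simp
  have R1 : ∀ ξ ∈ Set.Ioo β γ, β + e2 ≤ ξ → foldF ρ β γ e2 e3 h ξ = foldF ρ α γ e1 e3 h ξ := by
    intro ξ hξ hx
    obtain ⟨ha, hb⟩ := hξ
    simp only [foldF, bellFn]
    rw [O (ξ - β) e2 h2 (by linarith), O (ξ - α) e1 h1 (by linarith),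
      O (2 * γ - ξ - β) e2 h2 (by linarith), O (2 * γ - ξ - α) e1 h1 (by linarith),
      Z (2 * β - ξ - β) e2 h2 (by linarith), Z (2 * α - ξ - α) e1 h1 (by linarith)]
    simp
  have R2 : ∀ ξ ∈ Set.Ioo β γ, ξ < β + e2 → foldF ρ β γ e2 e3 h ξ =
      (ρ ((ξ - β) / e2) : ℂ) * h ξ + (ρ ((β - ξ) / e2) : ℂ) * h (2 * β - ξ) := by
    intro ξ hξ hx
    obtain ⟨ha, hb⟩ := hξ
    simp only [foldF, bellFn]
    rw [O (γ - ξ) e3 h3 (by linarith), Z (γ - (2 * γ - ξ)) e3 h3 (by linarith),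
      O (γ - (2 * β - ξ)) e3 h3 (by linarith)]
    have : 2 * β - ξ - β = β - ξ := by ring
    rw [this]; simp
  have sq : ∀ ξ, (ρ ((β - ξ) / e2) : ℂ) ^ 2 + (ρ ((ξ - β) / e2) : ℂ) ^ 2 = 1 := by
    intro ξ
    have := hρ.sq ((β - ξ) / e2)
    rw [← neg_div, neg_sub] at this
    exact_mod_cast this
  constructor
  · intro H
    have H' := hqmp.ae H
    constructor
    · filter_upwards [H, H'] with ξ hx hx' hI
      by_cases hc : ξ ≤ β - e2
      · rw [L1 ξ hI hc]; exact hx ⟨hI.1, by linarith [hI.2]⟩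
      · push Not at hc
        rw [L2 ξ hI hc]
        have a1 := hx ⟨hI.1, by linarith [hI.2]⟩
        have a2 := hx' ⟨by linarith [hI.2], by linarith⟩
        rw [C0 ξ hc (by linarith [hI.2])] at a1
        rw [C0 _ (by linarith [hI.2]) (by linarith)] at a2
        simp [a1, a2]
    · filter_upwards [H, H'] with ξ hx hx' hI
      by_cases hc : β + e2 ≤ ξ
      · rw [R1 ξ hI hc]; exact hx ⟨by linarith [hI.1], hI.2⟩
      · push Not at hc
        rw [R2 ξ hI hc]
        have a1 := hx ⟨by linarith [hI.1], hI.2⟩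
        have a2 := hx' ⟨by linarith, by linarith [hI.1]⟩
        rw [C0 ξ (by linarith [hI.1]) hc] at a1
        rw [C0 _ (by linarith) (by linarith [hI.1])] at a2
        simp [a1, a2]
  · rintro ⟨HA, HB⟩
    have HA' := hqmp.ae HA
    have HB' := hqmp.ae HB
    have hne : ∀ᵐ x : ℝ, x ≠ β := by simp [ae_iff, measure_singleton]
    filter_upwards [HA, HB, HA', HB', hne] with ξ ha hb ha' hb' hn hI
    rcases lt_or_gt_of_ne hn with hlt | hgt
    · have hI' : ξ ∈ Set.Ioo α β := ⟨hI.1, hlt⟩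
      by_cases hc : ξ ≤ β - e2
      · rw [← L1 ξ hI' hc]; exact ha hI'
      · push Not at hc
        rw [C0 ξ hc (by linarith)]
        have hJ : 2 * β - ξ ∈ Set.Ioo β γ := ⟨by linarith, by linarith⟩
        have a1 := ha hI'
        have a2 := hb' hJ
        rw [L2 ξ hI' hc] at a1
        rw [R2 _ hJ (by linarith)] at a2
        have r1 : 2 * β - ξ - β = β - ξ := by ring
        have r2 : β - (2 * β - ξ) = ξ - β := by ring
        rw [r1, r2, sub_sub_cancel] at a2
        linear_combination (ρ ((β - ξ) / e2) : ℂ) * a1 + (ρ ((ξ - β) / e2) : ℂ) * a2 - h ξ * sq ξ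
    · have hI' : ξ ∈ Set.Ioo β γ := ⟨hgt, hI.2⟩
      by_cases hc : β + e2 ≤ ξ
      · rw [← R1 ξ hI' hc]; exact hb hI'
      · push Not at hc
        rw [C0 ξ (by linarith) hc]
        have hJ : 2 * β - ξ ∈ Set.Ioo α β := ⟨by linarith, by linarith⟩
        have a1 := hb hI'
        have a2 := ha' hJ
        rw [R2 ξ hI' hc] at a1
        rw [L2 _ hJ (by linarith)] at a2
        have r1 : 2 * β - ξ - β = β - ξ := by ring
        have r2 : β - (2 * β - ξ) = ξ - β := by ring
        rw [r1, r2, sub_sub_cancel] at a2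
        linear_combination (ρ ((ξ - β) / e2) : ℂ) * a1 - (ρ ((β - ξ) / e2) : ℂ) * a2 - h ξ * sq ξ
lemma hat_orth_adj {ρ : ℝ → ℝ} (hρ : IsRamp ρ) {α β γ e1 e2 e3 : ℝ} (h1 : 0 < e1) (h2 : 0 < e2)
    (h3 : 0 < e3) (hab : e1 + e2 ≤ β - α) (hbc : e2 + e3 ≤ γ - β) (n m : ℕ) :
    ∫ ξ, (brushletHat ρ α β e1 e2 n ξ : ℂ) * (brushletHat ρ β γ e2 e3 m ξ : ℂ) = 0 := by
  set f : ℝ → ℂ := fun ξ => (brushletHat ρ α β e1 e2 n ξ : ℂ) * (brushletHat ρ β γ e2 e3 m ξ : ℂ)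
    with hf
  have hodd : ∀ ξ, f (2 * β - ξ) = - f ξ := by
    intro ξ
    have hba : β - α ≠ 0 := by linarith
    have c1 : Real.cos (Real.pi * ((n : ℝ) + 1 / 2) * (2 * β - ξ - α) / (β - α)) =
        - Real.cos (Real.pi * ((n : ℝ) + 1 / 2) * (ξ - α) / (β - α)) := by
      have : Real.pi * ((n : ℝ) + 1 / 2) * (2 * β - ξ - α) / (β - α) =
          Real.pi - Real.pi * ((n : ℝ) + 1 / 2) * (ξ - α) / (β - α) + n * (2 * Real.pi) := by
        field_simp; ring
      rw [this, Real.cos_add_nat_mul_two_pi, Real.cos_pi_sub]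
    have c2 : Real.cos (Real.pi * ((m : ℝ) + 1 / 2) * (2 * β - ξ - β) / (γ - β)) =
        Real.cos (Real.pi * ((m : ℝ) + 1 / 2) * (ξ - β) / (γ - β)) := by
      rw [← Real.cos_neg]; congr 1; ring
    have hb : bellFn ρ α β e1 e2 (2 * β - ξ) * bellFn ρ β γ e2 e3 (2 * β - ξ) =
        bellFn ρ α β e1 e2 ξ * bellFn ρ β γ e2 e3 ξ := by
      by_cases ha : ξ ≤ β - e2
      · rw [bell_zero_right hρ h2 (ξ := 2 * β - ξ) (by linarith),
          bell_zero_left hρ (α := β) h2 (ξ := ξ) (by linarith)]; simp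
      by_cases hb : β + e2 ≤ ξ
      · rw [bell_zero_left hρ (α := β) h2 (ξ := 2 * β - ξ) (by linarith),
          bell_zero_right hρ h2 (ξ := ξ) (by linarith)]; simp
      push Not at ha hb
      simp only [bellFn]
      rw [hρ.one_of_le h1 (x := ξ - α) (by linarith), hρ.one_of_le h1 (x := 2 * β - ξ - α) (by linarith),
        hρ.one_of_le h3 (x := γ - ξ) (by linarith), hρ.one_of_le h3 (x := γ - (2 * β - ξ)) (by linarith)]
      have r1 : 2 * β - ξ - β = β - ξ := by ring
      have r2 : β - (2 * β - ξ) = ξ - β := by ring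
      rw [r1, r2]; ring
    simp only [hf, brushletHat, c1, c2]
    norm_cast
    linear_combination (-(Real.sqrt (2 / (β - α)) * Real.sqrt (2 / (γ - β)) *
      Real.cos (Real.pi * ((n : ℝ) + 1 / 2) * (ξ - α) / (β - α)) *
      Real.cos (Real.pi * ((m : ℝ) + 1 / 2) * (ξ - β) / (γ - β)))) * hb
  have := integral_sub_left_eq_self f volume (2 * β)
  simp only [hodd, integral_neg] at this
  exact self_eq_neg.1 this.symm

lemma hat_orth_far {ρ : ℝ → ℝ} (hρ : IsRamp ρ) {α β γ δ e1 e2 e3 e4 : ℝ} (h2 : 0 < e2)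
    (h3 : 0 < e3) (hbc : e2 + e3 ≤ γ - β) (n m : ℕ) :
    ∫ ξ, (brushletHat ρ α β e1 e2 n ξ : ℂ) * (brushletHat ρ γ δ e3 e4 m ξ : ℂ) = 0 := by
  have : ∀ ξ, (brushletHat ρ α β e1 e2 n ξ : ℂ) * (brushletHat ρ γ δ e3 e4 m ξ : ℂ) = 0 := by
    intro ξ
    rcases le_total (β + e2) ξ with h | h
    · simp [brushletHat, bell_zero_right hρ h2 h]
    · simp [brushletHat, bell_zero_left hρ (α := γ) h3 (show ξ ≤ γ - e3 by linarith)]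
  simp [this]

lemma hat_scale (ρ : ℝ → ℝ) (α β e e' : ℝ) (n : ℕ) (ξ : ℝ) :
    brushletHat ρ α β e e' n (2 * Real.pi * ξ) = (Real.sqrt (2 * Real.pi))⁻¹ *
      brushletHat ρ (α / (2 * Real.pi)) (β / (2 * Real.pi)) (e / (2 * Real.pi)) (e' / (2 * Real.pi)) n ξ := by
  have hp : 0 < 2 * Real.pi := by positivity
  have hs : Real.sqrt (2 * Real.pi) ≠ 0 := (Real.sqrt_pos.2 hp).ne'
  have e1 : (2 * Real.pi * ξ - α) / e = (ξ - α / (2 * Real.pi)) / (e / (2 * Real.pi)) := by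
    rw [div_div_eq_mul_div]; congr 1; field_simp
  have e2 : (β - 2 * Real.pi * ξ) / e' = (β / (2 * Real.pi) - ξ) / (e' / (2 * Real.pi)) := by
    rw [div_div_eq_mul_div]; congr 1; field_simp
  have e3 : Real.pi * ((n : ℝ) + 1 / 2) * (2 * Real.pi * ξ - α) / (β - α) =
      Real.pi * ((n : ℝ) + 1 / 2) * (ξ - α / (2 * Real.pi)) / (β / (2 * Real.pi) - α / (2 * Real.pi)) := by
    rw [← sub_div, div_div_eq_mul_div]; congr 1; field_simp
  have e4 : Real.sqrt (2 / (β - α)) = (Real.sqrt (2 * Real.pi))⁻¹ *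
      Real.sqrt (2 / (β / (2 * Real.pi) - α / (2 * Real.pi))) := by
    rw [← sub_div, div_div_eq_mul_div, mul_comm 2 (2 * Real.pi), mul_div_assoc,
      Real.sqrt_mul hp.le, inv_mul_cancel_left₀ hs]
  simp only [brushletHat, bellFn]
  rw [e1, e2, e3, e4]; ring

open scoped FourierTransform SchwartzMap in
lemma brushlet_eq_fourierInv (ρ : ℝ → ℝ) (α β e e' : ℝ) (n : ℕ) (x : ℝ) :
    brushlet ρ α β e e' n x = 𝓕⁻ (fun ξ : ℝ => (brushletHat ρ (α / (2 * Real.pi)) (β / (2 * Real.pi))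
      (e / (2 * Real.pi)) (e' / (2 * Real.pi)) n ξ : ℂ)) x := by
  have hp : 0 < 2 * Real.pi := by positivity
  have hs : Real.sqrt (2 * Real.pi) ≠ 0 := (Real.sqrt_pos.2 hp).ne'
  have hs' : (Real.sqrt (2 * Real.pi) : ℂ) ≠ 0 := by exact_mod_cast hs
  have hsq : (Real.sqrt (2 * Real.pi) : ℂ) * (Real.sqrt (2 * Real.pi) : ℂ) = 2 * Real.pi := by
    have := Real.mul_self_sqrt hp.le
    exact_mod_cast this
  rw [brushlet, invFourier, Real.fourierInv_eq']
  have h := Measure.integral_comp_mul_left (fun ξ : ℝ => (brushletHat ρ α β e e' n ξ : ℂ) *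
    Complex.exp (Complex.I * x * ξ)) (2 * Real.pi)
  rw [abs_of_pos (inv_pos.2 hp)] at h
  have h' : ∫ ξ : ℝ, (brushletHat ρ α β e e' n ξ : ℂ) * Complex.exp (Complex.I * x * ξ) =
      (2 * Real.pi) • ∫ ξ : ℝ, (brushletHat ρ α β e e' n (2 * Real.pi * ξ) : ℂ) *
        Complex.exp (Complex.I * x * ((2 * Real.pi * ξ : ℝ) : ℂ)) := by
    rw [h, smul_smul, mul_inv_cancel₀ hp.ne', one_smul]
  rw [h', Complex.real_smul, ← mul_assoc, ← integral_const_mul]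
  congr 1; ext ξ
  rw [hat_scale]
  simp only [smul_eq_mul]
  have : Complex.exp (Complex.I * x * ((2 * Real.pi * ξ : ℝ) : ℂ)) =
      Complex.exp (((2 * Real.pi * inner ℝ ξ x : ℝ) : ℂ) * Complex.I) := by
    congr 1
    simp
    ring
  rw [this]
  push_cast
  rw [← hsq]
  field_simp

lemma hat_contDiff {ρ : ℝ → ℝ} (hρ : IsRamp ρ) (α β e e' : ℝ) (n : ℕ) :
    ContDiff ℝ (⊤ : ℕ∞) (fun ξ : ℝ => (brushletHat ρ α β e e' n ξ : ℂ)) := by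
  rw [contDiff_infty]
  intro m
  have h1 := bell_contDiff hρ α β e e' m
  have h2 : ContDiff ℝ m (brushletHat ρ α β e e' n) := by
    unfold brushletHat
    have : ContDiff ℝ m (fun ξ : ℝ => Real.cos (Real.pi * ((n : ℝ) + 1 / 2) * (ξ - α) / (β - α))) := by
      fun_prop
    fun_prop
  exact Complex.ofRealCLM.contDiff.comp h2

lemma hat_cpt {ρ : ℝ → ℝ} (hρ : IsRamp ρ) {α β e e' : ℝ} (he : 0 < e) (he' : 0 < e') (n : ℕ) :
    HasCompactSupport (fun ξ : ℝ => (brushletHat ρ α β e e' n ξ : ℂ)) := by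
  have h1 : HasCompactSupport (brushletHat ρ α β e e' n) := by
    unfold brushletHat
    exact ((bell_cpt hρ he he').mul_left).mul_right
  exact h1.comp_left (g := fun x : ℝ => (x : ℂ)) (by simp)

open Classical in
/-- The brushlet as an element of `L²(ℝ)`. -/
noncomputable def brS (ρ : ℝ → ℝ) (α β e e' : ℝ) (n : ℕ) : Lp ℂ 2 (volume : Measure ℝ) :=
  if h : MemLp (brushlet ρ α β e e' n) 2 (volume : Measure ℝ) then h.toLp _ else 0

open scoped FourierTransform SchwartzMap in
lemma brS_spec {ρ : ℝ → ℝ} (hρ : IsRamp ρ) {α β e e' : ℝ} (he : 0 < e) (he' : 0 < e') (n : ℕ) :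
    (brS ρ α β e e' n =ᵐ[volume] brushlet ρ α β e e' n) ∧
    ∃ f : 𝓢(ℝ, ℂ), (∀ ξ, f ξ = (brushletHat ρ (α / (2 * Real.pi)) (β / (2 * Real.pi))
      (e / (2 * Real.pi)) (e' / (2 * Real.pi)) n ξ : ℂ)) ∧
      brS ρ α β e e' n = 𝓕⁻ (f.toLp 2 (volume : Measure ℝ)) := by
  have hp : 0 < 2 * Real.pi := by positivity
  let f : 𝓢(ℝ, ℂ) := (hat_cpt hρ (α := α / (2 * Real.pi)) (β := β / (2 * Real.pi))
    (div_pos he hp) (div_pos he' hp) n).toSchwartzMap (hat_contDiff hρ _ _ _ _ n)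
  have hf : ∀ ξ, f ξ = (brushletHat ρ (α / (2 * Real.pi)) (β / (2 * Real.pi))
      (e / (2 * Real.pi)) (e' / (2 * Real.pi)) n ξ : ℂ) := fun ξ => rfl
  have hb : brushlet ρ α β e e' n = ⇑(𝓕⁻ f : 𝓢(ℝ, ℂ)) := by
    ext x
    rw [brushlet_eq_fourierInv, SchwartzMap.fourierInv_coe]
    rfl
  have hm : MemLp (brushlet ρ α β e e' n) 2 (volume : Measure ℝ) := by
    rw [hb]; exact (𝓕⁻ f).memLp 2 volume
  have hS : brS ρ α β e e' n = hm.toLp _ := by rw [brS, dif_pos hm]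
  refine ⟨by rw [hS]; exact hm.coeFn_toLp, f, hf, ?_⟩
  rw [SchwartzMap.toLp_fourierInv_eq, hS]
  apply Lp.ext
  filter_upwards [hm.coeFn_toLp, (𝓕⁻ f).coeFn_toLp 2 volume] with x h1 h2
  rw [h1, h2, hb]

open scoped FourierTransform SchwartzMap in
lemma inner_brS {ρ : ℝ → ℝ} (hρ : IsRamp ρ) {α β e e' : ℝ} (he : 0 < e) (he' : 0 < e') (n : ℕ)
    (h : Lp ℂ 2 (volume : Measure ℝ)) :
    inner ℂ (brS ρ α β e e' n) h = ∫ ξ, (brushletHat ρ (α / (2 * Real.pi)) (β / (2 * Real.pi))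
      (e / (2 * Real.pi)) (e' / (2 * Real.pi)) n ξ : ℂ) * (𝓕 h : Lp ℂ 2 (volume : Measure ℝ)) ξ := by
  obtain ⟨-, f, hf, hS⟩ := brS_spec (α := α) (β := β) hρ he he' n
  rw [hS, ← Lp.inner_fourier_eq, FourierTransform.fourier_fourierInv_eq, L2.inner_def]
  apply integral_congr_ae
  filter_upwards [f.coeFn_toLp 2 volume] with x hx
  rw [hx, hf]
  simp [mul_comm]

open scoped FourierTransform SchwartzMap in
lemma inner_brS_brS {ρ : ℝ → ℝ} (hρ : IsRamp ρ) {α β e1 e2 γ δ e3 e4 : ℝ} (h1 : 0 < e1) (h2 : 0 < e2)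
    (h3 : 0 < e3) (h4 : 0 < e4) (n m : ℕ) :
    inner ℂ (brS ρ α β e1 e2 n) (brS ρ γ δ e3 e4 m) =
      ∫ ξ, (brushletHat ρ (α / (2 * Real.pi)) (β / (2 * Real.pi))
      (e1 / (2 * Real.pi)) (e2 / (2 * Real.pi)) n ξ : ℂ) *
      (brushletHat ρ (γ / (2 * Real.pi)) (δ / (2 * Real.pi))
      (e3 / (2 * Real.pi)) (e4 / (2 * Real.pi)) m ξ : ℂ) := by
  rw [inner_brS hρ h1 h2]
  obtain ⟨-, f, hf, hS⟩ := brS_spec (α := γ) (β := δ) hρ h3 h4 m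
  rw [hS, FourierTransform.fourier_fourierInv_eq]
  apply integral_congr_ae
  filter_upwards [f.coeFn_toLp 2 volume] with x hx
  rw [hx, hf]

lemma brS_orth_adj {ρ : ℝ → ℝ} (hρ : IsRamp ρ) {α β γ e1 e2 e3 : ℝ} (h1 : 0 < e1) (h2 : 0 < e2)
    (h3 : 0 < e3) (hab : e1 + e2 ≤ β - α) (hbc : e2 + e3 ≤ γ - β) (n m : ℕ) :
    inner ℂ (brS ρ α β e1 e2 n) (brS ρ β γ e2 e3 m) = 0 := by
  have hp : 0 < 2 * Real.pi := by positivity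
  rw [inner_brS_brS hρ h1 h2 h2 h3]
  apply hat_orth_adj hρ (div_pos h1 hp) (div_pos h2 hp) (div_pos h3 hp)
  · rw [← add_div, ← sub_div]; gcongr
  · rw [← add_div, ← sub_div]; gcongr

lemma brS_orth_far {ρ : ℝ → ℝ} (hρ : IsRamp ρ) {α β γ δ e1 e2 e3 e4 : ℝ} (h1 : 0 < e1) (h2 : 0 < e2)
    (h3 : 0 < e3) (h4 : 0 < e4) (hbc : e2 + e3 ≤ γ - β) (n m : ℕ) :
    inner ℂ (brS ρ α β e1 e2 n) (brS ρ γ δ e3 e4 m) = 0 := by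
  have hp : 0 < 2 * Real.pi := by positivity
  rw [inner_brS_brS hρ h1 h2 h3 h4]
  apply hat_orth_far hρ (div_pos h2 hp) (div_pos h3 hp)
  rw [← add_div, ← sub_div]; gcongr

lemma brS_perp_split {ρ : ℝ → ℝ} (hρ : IsRamp ρ) {α β γ e1 e2 e3 : ℝ} (h1 : 0 < e1) (h2 : 0 < e2)
    (h3 : 0 < e3) (hab : e1 + e2 ≤ β - α) (hbc : e2 + e3 ≤ γ - β)
    (h : Lp ℂ 2 (volume : Measure ℝ)) :
    (∀ n, inner ℂ (brS ρ α γ e1 e3 n) h = 0) ↔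
      (∀ n, inner ℂ (brS ρ α β e1 e2 n) h = 0) ∧ (∀ n, inner ℂ (brS ρ β γ e2 e3 n) h = 0) := by
  have hp : 0 < 2 * Real.pi := by positivity
  simp only [inner_brS hρ h1 h2, inner_brS hρ h2 h3, inner_brS hρ h1 h3]
  have hab' : e1 / (2 * Real.pi) + e2 / (2 * Real.pi) ≤ β / (2 * Real.pi) - α / (2 * Real.pi) := by
    rw [← add_div, ← sub_div]; gcongr
  have hbc' : e2 / (2 * Real.pi) + e3 / (2 * Real.pi) ≤ γ / (2 * Real.pi) - β / (2 * Real.pi) := by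
    rw [← add_div, ← sub_div]; gcongr
  have p1 := div_pos h1 hp
  have p2 := div_pos h2 hp
  have p3 := div_pos h3 hp
  rw [fold_iff hρ p1 p3 (by linarith) _ (Lp.memLp _), fold_iff hρ p1 p2 hab' _ (Lp.memLp _),
    fold_iff hρ p2 p3 hbc' _ (Lp.memLp _)]
  exact fold_split hρ p1 p2 p3 hab' hbc' _
section Tensor

variable {d : ℕ}

lemma qmp_coord (i : Fin d) : Measure.QuasiMeasurePreserving
    (fun x : EuclideanSpace ℝ (Fin d) => x i) volume volume :=
  (Measure.quasiMeasurePreserving_eval (fun _ : Fin d => (volume : Measure ℝ)) i).comp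
    (PiLp.volume_preserving_ofLp (Fin d)).quasiMeasurePreserving

lemma integral_prod_coord (f : Fin d → ℝ → ℂ) :
    ∫ x : EuclideanSpace ℝ (Fin d), ∏ i, f i (x i) = ∏ i, ∫ t, f i t := by
  have := (PiLp.volume_preserving_ofLp (Fin d)).integral_comp
    (MeasurableEquiv.toLp 2 (Fin d → ℝ)).symm.measurableEmbedding
    (fun y : Fin d → ℝ => ∏ i, f i (y i))
  rw [← integral_fintype_prod_volume_eq_prod f, ← this]

lemma memLp_prod (f : Fin d → Lp ℂ 2 (volume : Measure ℝ)) :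
    MemLp (fun x : EuclideanSpace ℝ (Fin d) => ∏ i, f i (x i)) 2 volume := by
  have hm : AEStronglyMeasurable (fun x : EuclideanSpace ℝ (Fin d) => ∏ i, f i (x i)) volume := by
    apply Finset.aestronglyMeasurable_fun_prod
    intro i _
    exact (Lp.aestronglyMeasurable (f i)).comp_quasiMeasurePreserving (qmp_coord i)
  rw [memLp_two_iff_integrable_sq_norm hm]
  have h1 : Integrable (fun y : Fin d → ℝ => ∏ i, ‖f i (y i)‖ ^ 2) volume := by
    apply Integrable.fintype_prod (f := fun i t => ‖f i t‖ ^ 2)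
    intro i
    exact (memLp_two_iff_integrable_sq_norm (Lp.aestronglyMeasurable (f i))).1 (Lp.memLp (f i))
  have h2 := (PiLp.volume_preserving_ofLp (Fin d)).integrable_comp_of_integrable h1
  refine h2.congr ?_
  filter_upwards with x
  simp [Finset.prod_pow]

noncomputable def tens (f : Fin d → Lp ℂ 2 (volume : Measure ℝ)) :
    Lp ℂ 2 (volume : Measure (EuclideanSpace ℝ (Fin d))) := (memLp_prod f).toLp _

lemma tens_coe (f : Fin d → Lp ℂ 2 (volume : Measure ℝ)) :
    tens f =ᵐ[volume] fun x : EuclideanSpace ℝ (Fin d) => ∏ i, f i (x i) :=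
  (memLp_prod f).coeFn_toLp

lemma tens_inner (f g : Fin d → Lp ℂ 2 (volume : Measure ℝ)) :
    inner ℂ (tens f) (tens g) = ∏ i, inner ℂ (f i) (g i) := by
  simp only [L2.inner_def]
  rw [← integral_prod_coord (fun i t => inner ℂ (f i t) (g i t))]
  apply integral_congr_ae
  filter_upwards [tens_coe f, tens_coe g] with x h1 h2
  rw [h1, h2]
  simp [Finset.prod_mul_distrib, map_prod]

lemma tens_norm (f : Fin d → Lp ℂ 2 (volume : Measure ℝ)) : ‖tens f‖ = ∏ i, ‖f i‖ := by
  have h := tens_inner f f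
  simp only [inner_self_eq_norm_sq_to_K] at h
  rw [Finset.prod_pow, ← map_prod] at h
  have h' : ‖tens f‖ ^ 2 = (∏ i, ‖f i‖) ^ 2 := by
    have h2 : ((‖tens f‖ ^ 2 : ℝ) : ℂ) = (((∏ i, ‖f i‖) ^ 2 : ℝ) : ℂ) := by
      push_cast
      simpa using h
    exact_mod_cast h2
  exact (pow_left_inj₀ (norm_nonneg _) (Finset.prod_nonneg fun _ _ => norm_nonneg _) two_ne_zero).1 h'

lemma tens_update_coe [DecidableEq (Fin d)] (f : Fin d → Lp ℂ 2 (volume : Measure ℝ)) (i : Fin d)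
    (u : Lp ℂ 2 (volume : Measure ℝ)) :
    tens (Function.update f i u) =ᵐ[volume] fun x : EuclideanSpace ℝ (Fin d) =>
      u (x i) * ∏ l ∈ Finset.univ \ {i}, f l (x l) := by
  filter_upwards [tens_coe (Function.update f i u)] with x hx
  rw [hx]
  have : ∀ l, (Function.update f i u l : ℝ → ℂ) (x l) =
      Function.update (fun l => f l (x l)) i (u (x i)) l := by
    intro l
    by_cases h : l = i
    · subst h; simp
    · simp [h]
  simp_rw [this]
  rw [Finset.prod_update_of_mem (Finset.mem_univ i)]

noncomputable def tensM : MultilinearMap ℂ (fun _ : Fin d => Lp ℂ 2 (volume : Measure ℝ))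
    (Lp ℂ 2 (volume : Measure (EuclideanSpace ℝ (Fin d)))) where
  toFun := tens
  map_update_add' := by
    intro _ f i u v
    apply Lp.ext
    filter_upwards [tens_update_coe f i (u + v), tens_update_coe f i u, tens_update_coe f i v,
      Lp.coeFn_add (tens (Function.update f i u)) (tens (Function.update f i v)),
      (qmp_coord i).ae_eq (Lp.coeFn_add u v)] with x h1 h2 h3 h4 h5
    have h5' : (u + v : Lp ℂ 2 (volume : Measure ℝ)) (x i) = u (x i) + v (x i) := h5
    rw [h1, h4, Pi.add_apply, h2, h3, h5', add_mul]
  map_update_smul' := by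
    intro _ f i c u
    apply Lp.ext
    filter_upwards [tens_update_coe f i (c • u), tens_update_coe f i u,
      Lp.coeFn_smul c (tens (Function.update f i u)),
      (qmp_coord i).ae_eq (Lp.coeFn_smul c u)] with x h1 h2 h4 h5
    have h5' : (c • u : Lp ℂ 2 (volume : Measure ℝ)) (x i) = c * u (x i) := h5
    rw [h1, h4, Pi.smul_apply, h2, h5', smul_eq_mul, mul_assoc]

lemma tens_continuous : Continuous (tens (d := d)) :=
  (tensM.mkContinuous 1 (fun m => by rw [one_mul]; exact (tens_norm m).le)).cont

lemma tens_mem_span (S : Fin d → Set (Lp ℂ 2 (volume : Measure ℝ)))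
    (f : Fin d → Lp ℂ 2 (volume : Measure ℝ)) (hf : ∀ i, f i ∈ Submodule.span ℂ (S i)) :
    tens f ∈ Submodule.span ℂ (tens '' (Set.univ.pi S)) := by
  classical
  suffices H : ∀ (s : Finset (Fin d)) (f : Fin d → Lp ℂ 2 (volume : Measure ℝ)),
      (∀ i, f i ∈ Submodule.span ℂ (S i)) → (∀ i ∉ s, f i ∈ S i) →
      tens f ∈ Submodule.span ℂ (tens '' (Set.univ.pi S)) by
    exact H Finset.univ f hf (by simp)
  intro s
  induction s using Finset.induction_on with
  | empty =>
    intro f _ h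
    exact Submodule.subset_span ⟨f, fun i _ => h i (by simp), rfl⟩
  | insert i s his ih =>
    intro f hf h
    have key : ∀ u ∈ Submodule.span ℂ (S i),
        tens (Function.update f i u) ∈ Submodule.span ℂ (tens '' (Set.univ.pi S)) := by
      intro u hu
      induction hu using Submodule.span_induction with
      | mem u hu =>
        apply ih
        · intro l
          by_cases hl : l = i
          · subst hl; simpa using Submodule.subset_span hu
          · simpa [hl] using hf l
        · intro l hls
          by_cases hl : l = i
          · subst hl; simpa using hu
          · simpa [hl] using h l (by simp [hl, hls])
      | zero =>
        have : tens (Function.update f i 0) = 0 := tensM.map_update_zero f i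
        rw [this]; exact Submodule.zero_mem _
      | add u v _ _ hu hv =>
        have : tens (Function.update f i (u + v)) = _ := tensM.map_update_add f i u v
        rw [this]; exact Submodule.add_mem _ hu hv
      | smul c u _ hu =>
        have : tens (Function.update f i (c • u)) = _ := tensM.map_update_smul f i c u
        rw [this]; exact Submodule.smul_mem _ _ hu
    have := key (f i) (hf i)
    rwa [Function.update_eq_self] at this

lemma tens_mem_closure (S : Fin d → Set (Lp ℂ 2 (volume : Measure ℝ)))
    (f : Fin d → Lp ℂ 2 (volume : Measure ℝ))
    (hf : ∀ i, f i ∈ (Submodule.span ℂ (S i)).topologicalClosure) :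
    tens f ∈ (Submodule.span ℂ (tens '' (Set.univ.pi S))).topologicalClosure := by
  have h1 : f ∈ closure (Set.univ.pi fun i => (Submodule.span ℂ (S i) : Set (Lp ℂ 2 (volume : Measure ℝ)))) := by
    rw [closure_pi_set]
    intro i _
    exact hf i
  have h2 := image_closure_subset_closure_image tens_continuous ⟨f, h1, rfl⟩
  refine closure_mono ?_ h2
  rintro _ ⟨g, hg, rfl⟩
  exact tens_mem_span S g (fun i => hg i trivial)

lemma tens_closure_eq (S S' : Fin d → Set (Lp ℂ 2 (volume : Measure ℝ)))
    (h : ∀ i, (Submodule.span ℂ (S i)).topologicalClosure = (Submodule.span ℂ (S' i)).topologicalClosure) :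
    (Submodule.span ℂ (tens '' (Set.univ.pi S))).topologicalClosure =
      (Submodule.span ℂ (tens '' (Set.univ.pi S'))).topologicalClosure := by
  have aux : ∀ S S' : Fin d → Set (Lp ℂ 2 (volume : Measure ℝ)),
    (∀ i, (Submodule.span ℂ (S i)).topologicalClosure = (Submodule.span ℂ (S' i)).topologicalClosure) →
    (Submodule.span ℂ (tens '' (Set.univ.pi S))).topologicalClosure ≤
      (Submodule.span ℂ (tens '' (Set.univ.pi S'))).topologicalClosure := by
    intro S S' h
    apply Submodule.topologicalClosure_minimal _ _ (Submodule.isClosed_topologicalClosure _)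
    rw [Submodule.span_le]
    rintro _ ⟨f, hf, rfl⟩
    apply tens_mem_closure
    intro i
    rw [← h i]
    exact Submodule.le_topologicalClosure _ (Submodule.subset_span (hf i trivial))
  exact le_antisymm (aux _ _ h) (aux _ _ fun i => (h i).symm)

end Tensor

lemma closure_span_eq_of_perp {H : Type*} [NormedAddCommGroup H] [InnerProductSpace ℂ H]
    [CompleteSpace H] (A B : Set H)
    (h : ∀ x, (∀ a ∈ A, inner ℂ a x = 0) ↔ (∀ b ∈ B, inner ℂ b x = 0)) :
    (Submodule.span ℂ A).topologicalClosure = (Submodule.span ℂ B).topologicalClosure := by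
  rw [← Submodule.orthogonal_orthogonal_eq_closure, ← Submodule.orthogonal_orthogonal_eq_closure]
  congr 1
  have aux : ∀ (A : Set H) x, x ∈ (Submodule.span ℂ A)ᗮ ↔ ∀ a ∈ A, inner ℂ a x = 0 := by
    intro A x
    rw [Submodule.mem_orthogonal]
    constructor
    · intro h a ha; exact h a (Submodule.subset_span ha)
    · intro h u hu
      induction hu using Submodule.span_induction with
      | mem a ha => exact h a ha
      | zero => simp
      | add u v _ _ hu hv => rw [inner_add_left, hu, hv, add_zero]
      | smul c u _ hu => rw [inner_smul_left, hu, mul_zero]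
  ext x
  rw [aux, aux, h]

lemma closure_perp {H : Type*} [NormedAddCommGroup H] [InnerProductSpace ℂ H]
    (A B : Set H) (h : ∀ a ∈ A, ∀ b ∈ B, inner ℂ a b = 0) :
    ∀ u ∈ (Submodule.span ℂ A).topologicalClosure, ∀ v ∈ (Submodule.span ℂ B).topologicalClosure,
      inner ℂ u v = 0 := by
  have hAB : Submodule.span ℂ A ⟂ Submodule.span ℂ B := by
    rw [Submodule.isOrtho_span]
    intro a ha b hb; exact h a ha b hb
  have h1 : Submodule.span ℂ B ≤ ((Submodule.span ℂ A).topologicalClosure)ᗮ := by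
    have hA := Submodule.topologicalClosure_minimal _ hAB.le (Submodule.isClosed_orthogonal _)
    exact (Submodule.isOrtho_iff_le.2 hA).ge
  have h2 := Submodule.topologicalClosure_minimal _ h1 (Submodule.isClosed_orthogonal _)
  intro u hu v hv
  exact (Submodule.mem_orthogonal _ _).1 (h2 hv) u hu

lemma isClosed_sup_of_ortho {H : Type*} [NormedAddCommGroup H] [InnerProductSpace ℂ H]
    [CompleteSpace H] (U V : Submodule ℂ H) (hU : IsClosed (U : Set H)) (hV : IsClosed (V : Set H))
    (h : U ⟂ V) : IsClosed ((U ⊔ V : Submodule ℂ H) : Set H) := by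
  haveI : CompleteSpace U := hU.completeSpace_coe
  haveI : CompleteSpace V := hV.completeSpace_coe
  have : ((U ⊔ V : Submodule ℂ H) : Set H) = {x | U.starProjection x + V.starProjection x = x} := by
    ext x
    constructor
    · intro hx
      obtain ⟨u, hu, v, hv, rfl⟩ := Submodule.mem_sup.1 hx
      have a1 : U.starProjection u = u := Submodule.starProjection_eq_self_iff.2 hu
      have a2 : V.starProjection v = v := Submodule.starProjection_eq_self_iff.2 hv
      have a3 : U.starProjection v = 0 := by
        rw [Submodule.starProjection_apply_eq_zero_iff]; exact h.ge hv
      have a4 : V.starProjection u = 0 := by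
        rw [Submodule.starProjection_apply_eq_zero_iff]; exact h.le hu
      simp [a1, a2, a3, a4]
    · intro hx
      rw [Set.mem_setOf_eq] at hx
      rw [← hx]
      exact Submodule.add_mem_sup (Submodule.starProjection_apply_mem _ _)
        (Submodule.starProjection_apply_mem _ _)
  rw [this]
  exact isClosed_eq (by fun_prop) (by fun_prop)

lemma isClosed_biSup_of_ortho {H ι : Type*} [NormedAddCommGroup H] [InnerProductSpace ℂ H]
    [CompleteSpace H] (V : ι → Submodule ℂ H) (hV : ∀ k, IsClosed (V k : Set H)) (s : Finset ι)
    (h : ∀ k ∈ s, ∀ k' ∈ s, k ≠ k' → V k ⟂ V k') :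
    IsClosed ((⨆ k ∈ s, V k : Submodule ℂ H) : Set H) := by
  classical
  induction s using Finset.induction_on with
  | empty => simp
  | insert k s hks ih =>
    rw [Finset.iSup_insert]
    apply isClosed_sup_of_ortho _ _ (hV k)
    · exact ih fun k hk k' hk' => h k (by simp [hk]) k' (by simp [hk'])
    · rw [Submodule.isOrtho_iSup_right]
      intro k'
      rw [Submodule.isOrtho_iSup_right]
      intro hk'
      exact h k (by simp) k' (by simp [hk']) (fun e => hks (e ▸ hk'))
/-- One-dimensional brushlet attached to `I^i_{j,k}` as an `L²` element. -/
noncomputable def segB (ρ : ℝ → ℝ) (ai : ℝ) (j k : ℤ) (n : ℕ) : Lp ℂ 2 (volume : Measure ℝ) :=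
  brS ρ (lizL ai j k) (lizR ai j k) (lizEpsL ai j k) (lizEpsR ai j k) n

noncomputable def bigB (ρ : ℝ → ℝ) (ai : ℝ) (j : ℤ) (n : ℕ) : Lp ℂ 2 (volume : Measure ℝ) :=
  brS ρ (-((2 : ℝ) ^ ((j : ℝ) * ai))) ((2 : ℝ) ^ ((j : ℝ) * ai))
    ((2 : ℝ) ^ (((j : ℝ) - 2) * ai)) ((2 : ℝ) ^ (((j : ℝ) - 2) * ai)) n

lemma two_rpow_half {ai : ℝ} (ha : 1 ≤ ai) (t s : ℝ) (hts : t + 1 = s) :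
    2 * (2 : ℝ) ^ (t * ai) ≤ (2 : ℝ) ^ (s * ai) := by
  subst hts
  have : 2 * (2 : ℝ) ^ (t * ai) = (2 : ℝ) ^ (1 + t * ai) := by
    rw [Real.rpow_add two_pos, Real.rpow_one]
  rw [this]
  apply Real.rpow_le_rpow_of_exponent_le one_le_two
  nlinarith

lemma segB_orth {ρ : ℝ → ℝ} (hρ : IsRamp ρ) {ai : ℝ} (ha : 1 ≤ ai) (j k k' : ℤ)
    (hk : k = 1 ∨ k = -1 ∨ k = 2 ∨ k = -2) (hk' : k' = 1 ∨ k' = -1 ∨ k' = 2 ∨ k' = -2)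
    (hne : k ≠ k') (n m : ℕ) : inner ℂ (segB ρ ai j k n) (segB ρ ai j k' m) = 0 := by
  have i1 := two_rpow_half ha ((j : ℝ) - 1) j (by ring)
  have i2 := two_rpow_half ha ((j : ℝ) - 2) ((j : ℝ) - 1) (by ring)
  have i3 := two_rpow_half ha ((j : ℝ) - 3) ((j : ℝ) - 2) (by ring)
  have pA : 0 < (2 : ℝ) ^ (((j : ℝ) - 2) * ai) := by positivity
  have pB : 0 < (2 : ℝ) ^ (((j : ℝ) - 3) * ai) := by positivity
  have H : ∀ k k' : ℤ, (k = 1 ∨ k = -1 ∨ k = 2 ∨ k = -2) → (k' = 1 ∨ k' = -1 ∨ k' = 2 ∨ k' = -2) →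
      k < k' → ∀ n m, inner ℂ (segB ρ ai j k n) (segB ρ ai j k' m) = 0 := by
    intro k k' hk hk' hlt n m
    have s1 : ∀ n, segB ρ ai j 1 n = brS ρ 0 ((2 : ℝ) ^ (((j : ℝ) - 1) * ai))
        ((2 : ℝ) ^ (((j : ℝ) - 3) * ai)) ((2 : ℝ) ^ (((j : ℝ) - 3) * ai)) n := by
      intro n; simp only [segB, lizL, lizR, lizEpsL, lizEpsR]; norm_num
    have s2 : ∀ n, segB ρ ai j (-1) n = brS ρ (-((2 : ℝ) ^ (((j : ℝ) - 1) * ai))) 0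
        ((2 : ℝ) ^ (((j : ℝ) - 3) * ai)) ((2 : ℝ) ^ (((j : ℝ) - 3) * ai)) n := by
      intro n; simp only [segB, lizL, lizR, lizEpsL, lizEpsR]; norm_num
    have s3 : ∀ n, segB ρ ai j 2 n = brS ρ ((2 : ℝ) ^ (((j : ℝ) - 1) * ai))
        ((2 : ℝ) ^ ((j : ℝ) * ai))
        ((2 : ℝ) ^ (((j : ℝ) - 3) * ai)) ((2 : ℝ) ^ (((j : ℝ) - 2) * ai)) n := by
      intro n; simp only [segB, lizL, lizR, lizEpsL, lizEpsR]; norm_num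
    have s4 : ∀ n, segB ρ ai j (-2) n = brS ρ (-((2 : ℝ) ^ ((j : ℝ) * ai)))
        (-((2 : ℝ) ^ (((j : ℝ) - 1) * ai)))
        ((2 : ℝ) ^ (((j : ℝ) - 2) * ai)) ((2 : ℝ) ^ (((j : ℝ) - 3) * ai)) n := by
      intro n; simp only [segB, lizL, lizR, lizEpsL, lizEpsR]; norm_num
    rcases hk with rfl | rfl | rfl | rfl
    · rcases hk' with rfl | rfl | rfl | rfl
      · omega
      · omega
      · rw [s1, s3]; exact brS_orth_adj hρ pB pB pA (by linarith) (by linarith) n m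
      · omega
    · rcases hk' with rfl | rfl | rfl | rfl
      · rw [s2, s1]; exact brS_orth_adj hρ pB pB pB (by linarith) (by linarith) n m
      · omega
      · rw [s2, s3]; exact brS_orth_far hρ pB pB pB pA (by linarith) n m
      · omega
    · rcases hk' with rfl | rfl | rfl | rfl <;> omega
    · rcases hk' with rfl | rfl | rfl | rfl
      · rw [s4, s1]; exact brS_orth_far hρ pA pB pB pB (by linarith) n m
      · rw [s4, s2]; exact brS_orth_adj hρ pA pB pB (by linarith) (by linarith) n m
      · rw [s4, s3]; exact brS_orth_far hρ pA pB pB pA (by linarith) n m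
      · omega
  rcases lt_or_gt_of_ne hne with h | h
  · exact H k k' hk hk' h n m
  · rw [inner_eq_zero_symm]; exact H k' k hk' hk h m n

lemma bigB_closure {ρ : ℝ → ℝ} (hρ : IsRamp ρ) {ai : ℝ} (ha : 1 ≤ ai) (j : ℤ) :
    (Submodule.span ℂ (Set.range (bigB ρ ai j))).topologicalClosure =
    (Submodule.span ℂ {f | ∃ k : ℤ, (k = 1 ∨ k = -1 ∨ k = 2 ∨ k = -2) ∧
      ∃ n, segB ρ ai j k n = f}).topologicalClosure := by
  have i1 := two_rpow_half ha ((j : ℝ) - 1) j (by ring)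
  have i2 := two_rpow_half ha ((j : ℝ) - 2) ((j : ℝ) - 1) (by ring)
  have i3 := two_rpow_half ha ((j : ℝ) - 3) ((j : ℝ) - 2) (by ring)
  have pA : 0 < (2 : ℝ) ^ (((j : ℝ) - 2) * ai) := by positivity
  have pB : 0 < (2 : ℝ) ^ (((j : ℝ) - 3) * ai) := by positivity
  apply closure_span_eq_of_perp
  intro x
  have e1 : (∀ n, inner ℂ (bigB ρ ai j n) x = 0) ↔ ((∀ n, inner ℂ (segB ρ ai j (-2) n) x = 0) ∧
    (∀ n, inner ℂ (segB ρ ai j (-1) n) x = 0)) ∧ ((∀ n, inner ℂ (segB ρ ai j 1 n) x = 0) ∧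
    (∀ n, inner ℂ (segB ρ ai j 2 n) x = 0)) := by
    simp only [segB, bigB, lizL, lizR, lizEpsL, lizEpsR]
    norm_num
    rw [brS_perp_split hρ (β := 0) (e2 := (2 : ℝ) ^ (((j : ℝ) - 3) * ai)) pA pB pA
        (by linarith) (by linarith),
      brS_perp_split hρ (α := -(2 : ℝ) ^ ((j : ℝ) * ai)) (β := -(2 : ℝ) ^ (((j : ℝ) - 1) * ai))
        (γ := 0) pA pB pB (by linarith) (by linarith),
      brS_perp_split hρ (α := 0) (β := (2 : ℝ) ^ (((j : ℝ) - 1) * ai))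
        (γ := (2 : ℝ) ^ ((j : ℝ) * ai)) pB pB pA (by linarith) (by linarith)]
  rw [Set.forall_mem_range, e1]
  constructor
  · rintro ⟨⟨h1, h2⟩, h3, h4⟩ _ ⟨k, hk, n, rfl⟩
    rcases hk with rfl | rfl | rfl | rfl
    · exact h3 n
    · exact h2 n
    · exact h4 n
    · exact h1 n
  · intro h
    exact ⟨⟨fun n => h _ ⟨-2, by simp, n, rfl⟩, fun n => h _ ⟨-1, by simp, n, rfl⟩⟩,
      fun n => h _ ⟨1, by simp, n, rfl⟩, fun n => h _ ⟨2, by simp, n, rfl⟩⟩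

lemma bigB_closure_pred {ρ : ℝ → ℝ} (hρ : IsRamp ρ) {ai : ℝ} (ha : 1 ≤ ai) (j : ℤ) :
    (Submodule.span ℂ (Set.range (bigB ρ ai (j - 1)))).topologicalClosure =
    (Submodule.span ℂ {f | ∃ k : ℤ, (k = 1 ∨ k = -1) ∧
      ∃ n, segB ρ ai j k n = f}).topologicalClosure := by
  have i2 := two_rpow_half ha ((j : ℝ) - 2) ((j : ℝ) - 1) (by ring)
  have i3 := two_rpow_half ha ((j : ℝ) - 3) ((j : ℝ) - 2) (by ring)
  have pB : 0 < (2 : ℝ) ^ (((j : ℝ) - 3) * ai) := by positivity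
  apply closure_span_eq_of_perp
  intro x
  have e1 : (∀ n, inner ℂ (bigB ρ ai (j - 1) n) x = 0) ↔
    (∀ n, inner ℂ (segB ρ ai j (-1) n) x = 0) ∧ (∀ n, inner ℂ (segB ρ ai j 1 n) x = 0) := by
    have c1 : (((j - 1 : ℤ) : ℝ)) = (j : ℝ) - 1 := by push_cast; ring
    have c2 : (j : ℝ) - 1 - 2 = (j : ℝ) - 3 := by ring
    simp only [segB, bigB, lizL, lizR, lizEpsL, lizEpsR, c1, c2]
    norm_num
    rw [brS_perp_split hρ (β := 0) (e2 := (2 : ℝ) ^ (((j : ℝ) - 3) * ai)) pB pB pB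
        (by linarith) (by linarith)]
  rw [Set.forall_mem_range, e1]
  constructor
  · rintro ⟨h1, h2⟩ _ ⟨k, hk, n, rfl⟩
    rcases hk with rfl | rfl
    · exact h2 n
    · exact h1 n
  · intro h
    exact ⟨fun n => h _ ⟨-1, by simp, n, rfl⟩, fun n => h _ ⟨1, by simp, n, rfl⟩⟩

lemma eq_tens_of_ae {d : ℕ} (u : Lp ℂ 2 (volume : Measure (EuclideanSpace ℝ (Fin d))))
    (f : Fin d → Lp ℂ 2 (volume : Measure ℝ)) (g : Fin d → ℝ → ℂ)
    (hfg : ∀ i, f i =ᵐ[volume] g i)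
    (hu : (u : EuclideanSpace ℝ (Fin d) → ℂ) =ᵐ[volume] fun x => ∏ i, g i (x i)) : u = tens f := by
  apply Lp.ext
  have h := ae_all_iff.2 fun i => (qmp_coord i).ae_eq (hfg i)
  filter_upwards [hu, tens_coe f, h] with x h1 h2 h3
  rw [h1, h2]
  exact Finset.prod_congr rfl fun i _ => (h3 i).symm

lemma idxE2_finite (d : ℕ) :
    {k : Fin d → ℤ | ∀ i, k i = 1 ∨ k i = -1 ∨ k i = 2 ∨ k i = -2}.Finite := by
  have : {k : Fin d → ℤ | ∀ i, k i = 1 ∨ k i = -1 ∨ k i = 2 ∨ k i = -2} =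
      Set.univ.pi fun _ => ({1, -1, 2, -2} : Set ℤ) := by
    ext k; simp [Set.mem_pi]
  rw [this]
  exact Set.Finite.pi fun _ => by simp

/-- With `V_{j,k}` the closed span in `L²(ℝ^d;ℂ)` of
`{w_{n,R_{j,k}} : n ∈ ℕ₀^d}` and `W_j` the closed span of the tensor brushlets of the
big rectangle at level `j`: for every `j`, the `V_{j,k}` (`k ∈ E`) are pairwise
orthogonal, each is orthogonal to `W_{j−1}`, `W_{j−1} ⊆ W_j`, and
`W_j = W_{j−1} ⊕ (⊕_{k∈E} V_{j,k})` as an orthogonal direct sum. -/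
theorem stmt17 (d : ℕ) (hd : 0 < d) (a : Fin d → ℝ) (ha : ∀ i, 1 ≤ a i)
    (ρ : ℝ → ℝ) (hρsmooth : ∀ m : ℕ, ContDiff ℝ m ρ)
    (hρ0 : ∀ ξ, 0 ≤ ρ ξ) (hρ1 : ∀ ξ, ρ ξ ≤ 1)
    (hρneg : ∀ ξ, ξ ≤ -1 → ρ ξ = 0) (hρpos : ∀ ξ, 1 ≤ ξ → ρ ξ = 1)
    (hρsq : ∀ ξ, ρ ξ ^ 2 + ρ (-ξ) ^ 2 = 1)
    (WL : ℤ → (Fin d → ℤ) → (Fin d → ℕ) →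
      Lp ℂ 2 (volume : Measure (EuclideanSpace ℝ (Fin d))))
    (hWL : ∀ j k n, (WL j k n : EuclideanSpace ℝ (Fin d) → ℂ)
      =ᵐ[volume] mBrushlet d ρ a j k n)
    (WJL : ℤ → (Fin d → ℕ) → Lp ℂ 2 (volume : Measure (EuclideanSpace ℝ (Fin d))))
    (hWJL : ∀ j m, (WJL j m : EuclideanSpace ℝ (Fin d) → ℂ)
      =ᵐ[volume] mBrushletBig d ρ a j m) :
    ∀ j : ℤ,
      (∀ k k' : Fin d → ℤ, k ∈ idxE d → k' ∈ idxE d → k ≠ k' →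
        ∀ u ∈ (Submodule.span ℂ (Set.range (WL j k))).topologicalClosure,
        ∀ v ∈ (Submodule.span ℂ (Set.range (WL j k'))).topologicalClosure,
          @inner ℂ _ _ u v = 0) ∧
      (∀ k : Fin d → ℤ, k ∈ idxE d →
        ∀ u ∈ (Submodule.span ℂ (Set.range (WL j k))).topologicalClosure,
        ∀ v ∈ (Submodule.span ℂ (Set.range (WJL (j - 1)))).topologicalClosure,
          @inner ℂ _ _ u v = 0) ∧
      (Submodule.span ℂ (Set.range (WJL (j - 1)))).topologicalClosure ≤
        (Submodule.span ℂ (Set.range (WJL j))).topologicalClosure ∧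
      (Submodule.span ℂ (Set.range (WJL j))).topologicalClosure =
        (Submodule.span ℂ (Set.range (WJL (j - 1)))).topologicalClosure ⊔
          ⨆ k ∈ idxE d, (Submodule.span ℂ (Set.range (WL j k))).topologicalClosure := by

  intro j
  have hρ : IsRamp ρ := ⟨hρsmooth, hρ0, hρ1, hρneg, hρpos, hρsq⟩
  have epsL : ∀ i (k : ℤ), 0 < lizEpsL (a i) j k := by
    intro i k; unfold lizEpsL; split_ifs <;> positivity
  have epsR : ∀ i (k : ℤ), 0 < lizEpsR (a i) j k := by
    intro i k; unfold lizEpsR; split_ifs <;> positivity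
  have eWL : ∀ k n, WL j k n = tens (fun i => segB ρ (a i) j (k i) (n i)) := fun k n =>
    eq_tens_of_ae _ _ _ (fun i => (brS_spec hρ (epsL i (k i)) (epsR i (k i)) (n i)).1) (hWL j k n)
  have eWJ : ∀ l m, WJL l m = tens (fun i => bigB ρ (a i) l (m i)) := fun l m =>
    eq_tens_of_ae _ _ _ (fun i => (brS_spec hρ (by positivity) (by positivity) (m i)).1) (hWJL l m)
  have rWJ : ∀ l, Set.range (WJL l) = tens '' (Set.univ.pi fun i => Set.range (bigB ρ (a i) l)) := by
    intro l
    ext u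
    constructor
    · rintro ⟨m, rfl⟩
      exact ⟨_, fun i _ => ⟨m i, rfl⟩, (eWJ l m).symm⟩
    · rintro ⟨f, hf, rfl⟩
      choose m hm using fun i => hf i trivial
      refine ⟨m, ?_⟩
      rw [eWJ]
      congr 1; ext1 i; exact hm i
  -- sub-blocks
  have rK : ∀ P : ℤ → Prop, tens '' (Set.univ.pi fun i => {f | ∃ k : ℤ, P k ∧
      ∃ n, segB ρ (a i) j k n = f}) = {u | ∃ k : Fin d → ℤ, (∀ i, P (k i)) ∧ ∃ n, WL j k n = u} := by
    intro P
    ext u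
    constructor
    · rintro ⟨f, hf, rfl⟩
      choose k hk n hn using fun i => hf i trivial
      refine ⟨k, hk, n, ?_⟩
      rw [eWL]
      congr 1; ext1 i; exact hn i
    · rintro ⟨k, hk, n, rfl⟩
      exact ⟨_, fun i _ => ⟨k i, hk i, n i, rfl⟩, (eWL k n).symm⟩
  have cW : (Submodule.span ℂ (Set.range (WJL j))).topologicalClosure =
      (Submodule.span ℂ {u | ∃ k : Fin d → ℤ, (∀ i, k i = 1 ∨ k i = -1 ∨ k i = 2 ∨ k i = -2) ∧
        ∃ n, WL j k n = u}).topologicalClosure := by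
    rw [rWJ, ← rK (fun k => k = 1 ∨ k = -1 ∨ k = 2 ∨ k = -2)]
    exact tens_closure_eq _ _ fun i => bigB_closure hρ (ha i) j
  have cW' : (Submodule.span ℂ (Set.range (WJL (j - 1)))).topologicalClosure =
      (Submodule.span ℂ {u | ∃ k : Fin d → ℤ, (∀ i, k i = 1 ∨ k i = -1) ∧
        ∃ n, WL j k n = u}).topologicalClosure := by
    rw [rWJ, ← rK (fun k => k = 1 ∨ k = -1)]
    exact tens_closure_eq _ _ fun i => bigB_closure_pred hρ (ha i) j
  have orth : ∀ k k' : Fin d → ℤ, (∀ i, k i = 1 ∨ k i = -1 ∨ k i = 2 ∨ k i = -2) →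
      (∀ i, k' i = 1 ∨ k' i = -1 ∨ k' i = 2 ∨ k' i = -2) → k ≠ k' → ∀ n m,
      inner ℂ (WL j k n) (WL j k' m) = 0 := by
    intro k k' hk hk' hne n m
    obtain ⟨i, hi⟩ := Function.ne_iff.1 hne
    rw [eWL, eWL, tens_inner]
    exact Finset.prod_eq_zero (Finset.mem_univ i)
      (segB_orth hρ (ha i) j _ _ (hk i) (hk' i) hi _ _)
  have c12 : ∀ k : Fin d → ℤ, (∀ i, k i = 1 ∨ k i = -1) →
      (∀ i, k i = 1 ∨ k i = -1 ∨ k i = 2 ∨ k i = -2) := by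
    intro k hk i
    rcases hk i with h | h <;> simp [h]
  have P1 : ∀ k k' : Fin d → ℤ, k ∈ idxE d → k' ∈ idxE d → k ≠ k' →
        ∀ u ∈ (Submodule.span ℂ (Set.range (WL j k))).topologicalClosure,
        ∀ v ∈ (Submodule.span ℂ (Set.range (WL j k'))).topologicalClosure,
          @inner ℂ _ _ u v = 0 := by
    intro k k' hk hk' hne
    apply closure_perp
    rintro _ ⟨n, rfl⟩ _ ⟨m, rfl⟩
    exact orth k k' hk.1 hk'.1 hne n m
  have P2 : ∀ k : Fin d → ℤ, k ∈ idxE d →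
        ∀ u ∈ (Submodule.span ℂ (Set.range (WL j k))).topologicalClosure,
        ∀ v ∈ (Submodule.span ℂ (Set.range (WJL (j - 1)))).topologicalClosure,
          @inner ℂ _ _ u v = 0 := by
    intro k hk
    rw [cW']
    apply closure_perp
    rintro _ ⟨n, rfl⟩ _ ⟨k', hk', m, rfl⟩
    refine orth k k' hk.1 (c12 k' hk') ?_ n m
    rintro rfl
    exact hk.2 hk'
  have P3 : (Submodule.span ℂ (Set.range (WJL (j - 1)))).topologicalClosure ≤
        (Submodule.span ℂ (Set.range (WJL j))).topologicalClosure := by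
    rw [cW, cW']
    apply Submodule.topologicalClosure_mono
    apply Submodule.span_mono
    rintro _ ⟨k, hk, n, rfl⟩
    exact ⟨k, c12 k hk, n, rfl⟩
  refine ⟨P1, P2, P3, le_antisymm ?_ ?_⟩
  · have hfin : (idxE d).Finite := (idxE2_finite d).subset fun k hk => hk.1
    have hcl : IsClosed (((Submodule.span ℂ (Set.range (WJL (j - 1)))).topologicalClosure ⊔
        ⨆ k ∈ idxE d, (Submodule.span ℂ (Set.range (WL j k))).topologicalClosure :
          Submodule ℂ (Lp ℂ 2 (volume : Measure (EuclideanSpace ℝ (Fin d))))) :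
          Set (Lp ℂ 2 (volume : Measure (EuclideanSpace ℝ (Fin d))))) := by
      apply isClosed_sup_of_ortho _ _ (Submodule.isClosed_topologicalClosure _)
      · have := isClosed_biSup_of_ortho
          (fun k => (Submodule.span ℂ (Set.range (WL j k))).topologicalClosure)
          (fun k => Submodule.isClosed_topologicalClosure _) hfin.toFinset
          (fun k hk k' hk' hne => by
            rw [Submodule.isOrtho_iff_inner_eq]
            exact P1 k k' (by simpa using hk) (by simpa using hk') hne)
        simpa using this
      · simp only [Submodule.isOrtho_iSup_right]
        intro k hk
        rw [Submodule.isOrtho_comm, Submodule.isOrtho_iff_inner_eq]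
        exact P2 k hk
    conv_lhs => rw [cW]
    apply Submodule.topologicalClosure_minimal _ _ hcl
    rw [Submodule.span_le]
    rintro _ ⟨k, hk, n, rfl⟩
    by_cases hk1 : ∀ i, k i = 1 ∨ k i = -1
    · apply Submodule.mem_sup_left
      rw [cW']
      exact Submodule.le_topologicalClosure _ (Submodule.subset_span ⟨k, hk1, n, rfl⟩)
    · apply Submodule.mem_sup_right
      apply Submodule.mem_iSup_of_mem k
      apply Submodule.mem_iSup_of_mem (show k ∈ idxE d from ⟨hk, hk1⟩)
      exact Submodule.le_topologicalClosure _ (Submodule.subset_span ⟨n, rfl⟩)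
  · apply sup_le P3
    apply iSup₂_le
    intro k hk
    rw [cW]
    apply Submodule.topologicalClosure_mono
    apply Submodule.span_mono
    rintro _ ⟨n, rfl⟩
    exact ⟨k, hk.1, n, rfl⟩
end

section
/- For each j ∈ ℤ let Q_j denote the orthogonal projection of L²(ℝ^d; ℂ) onto W_j, the closed linear span of the tensor-product brushlets { x ↦ ∏_{i=1}^d w_{m_i, I_j^i}(x_i) : m ∈ ℕ₀^d }, where I_j^i := [−2^{j a_i}, 2^{j a_i}) carries cutoff radii 2^{(j−2)a_i} at both endpoints. Then for every f ∈ L²(ℝ^d; ℂ), one has Q_N f → f and Q_{−N} f → 0 in L²(ℝ^d; ℂ) as N → ∞. -/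
open MeasureTheory Filter

open scoped FourierTransform ContDiff SchwartzMap

/-- Tensor brushlet on the frequency side, in Mathlib's normalization. -/
noncomputable def gHat (d : ℕ) (ρ : ℝ → ℝ) (A e : Fin d → ℝ) (m : Fin d → ℕ)
    (η : EuclideanSpace ℝ (Fin d)) : ℂ :=
  ∏ i, ((brushletHat ρ (-(A i)) (A i) (e i) (e i) (m i) (2 * Real.pi * η i) : ℝ) : ℂ)

lemma bell_zero {ρ : ℝ → ℝ} (hρneg : ∀ ξ, ξ ≤ -1 → ρ ξ = 0) {A e ξ : ℝ} (he : 0 < e)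
    (h : A + e ≤ |ξ|) : bellFn ρ (-A) A e e ξ = 0 := by
  unfold bellFn
  rcases le_abs.1 h with h | h
  · rw [hρneg ((A - ξ) / e), mul_zero]
    rw [div_le_iff₀ he]; linarith
  · rw [hρneg ((ξ - -A) / e), zero_mul]
    rw [div_le_iff₀ he]; linarith

lemma bell_one {ρ : ℝ → ℝ} (hρpos : ∀ ξ, 1 ≤ ξ → ρ ξ = 1) {A e ξ : ℝ} (he : 0 < e)
    (h : |ξ| ≤ A - e) : bellFn ρ (-A) A e e ξ = 1 := by
  unfold bellFn
  have := abs_le.1 h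
  rw [hρpos, hρpos, mul_one] <;> rw [le_div_iff₀ he] <;> linarith

/-- Product functions that vanish when a coordinate is large have compact support. -/
lemma hasCompactSupport_of_coord {d : ℕ} (R : Fin d → ℝ) (F : EuclideanSpace ℝ (Fin d) → ℂ)
    (h : ∀ η, (∃ i, R i < |η i|) → F η = 0) : HasCompactSupport F := by
  have hK : IsCompact ((EuclideanSpace.equiv (Fin d) ℝ).symm ''
      (Set.univ.pi fun i => Set.Icc (-(R i)) (R i))) :=
    (isCompact_univ_pi fun i => isCompact_Icc).image
      (EuclideanSpace.equiv (Fin d) ℝ).symm.continuous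
  refine HasCompactSupport.intro hK fun η hη => h η ?_
  by_contra hcon
  push Not at hcon
  apply hη
  refine ⟨EuclideanSpace.equiv (Fin d) ℝ η, ?_, by simp⟩
  intro i _
  exact abs_le.1 (hcon i)

lemma gHat_zero {d : ℕ} {ρ : ℝ → ℝ} (hρneg : ∀ ξ, ξ ≤ -1 → ρ ξ = 0) {A e : Fin d → ℝ}
    (he : ∀ i, 0 < e i) (m : Fin d → ℕ) (η : EuclideanSpace ℝ (Fin d))
    (h : ∃ i, (A i + e i) / (2 * Real.pi) < |η i|) : gHat d ρ A e m η = 0 := by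
  obtain ⟨i, hi⟩ := h
  refine Finset.prod_eq_zero (Finset.mem_univ i) ?_
  rw [brushletHat, bell_zero hρneg (he i)]
  · simp
  · rw [abs_mul, abs_of_pos (by positivity : 0 < 2 * Real.pi)]
    rw [div_lt_iff₀ (by positivity)] at hi
    linarith

lemma gHat_contDiff {d : ℕ} {ρ : ℝ → ℝ} (hρsmooth : ∀ m : ℕ, ContDiff ℝ m ρ)
    (A e : Fin d → ℝ) (m : Fin d → ℕ) : ContDiff ℝ ∞ (gHat d ρ A e m) := by
  have hρ : ContDiff ℝ ∞ ρ := contDiff_infty.2 hρsmooth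
  unfold gHat brushletHat bellFn
  refine contDiff_prod fun i _ => ?_
  refine Complex.ofRealCLM.contDiff.comp ?_
  have hc : ContDiff ℝ ∞ (fun η : EuclideanSpace ℝ (Fin d) => η i) :=
    (EuclideanSpace.proj i : EuclideanSpace ℝ (Fin d) →L[ℝ] ℝ).contDiff
  refine ContDiff.mul (ContDiff.mul contDiff_const (ContDiff.mul (hρ.comp ?_) (hρ.comp ?_)))
    (Real.contDiff_cos.comp ?_) <;> fun_prop

lemma scale_integral (g : ℝ → ℂ) (x : ℝ) :
    ∫ t : ℝ, Complex.exp (2 * Real.pi * x * t * Complex.I) * g (2 * Real.pi * t)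
      = ((Real.sqrt (2 * Real.pi))⁻¹ : ℂ) * invFourier g x := by
  have h := Measure.integral_comp_mul_left
    (fun ξ : ℝ => g ξ * Complex.exp (Complex.I * x * ξ)) (2 * Real.pi)
  have h1 : ∫ t : ℝ, Complex.exp (2 * Real.pi * x * t * Complex.I) * g (2 * Real.pi * t)
      = ∫ t : ℝ, g (2 * Real.pi * t) * Complex.exp (Complex.I * x * ((2 * Real.pi * t : ℝ) : ℂ)) := by
    congr 1; ext t
    rw [mul_comm]; congr 2; push_cast; ring
  rw [h1, h, invFourier, abs_of_pos (by positivity), ← mul_assoc, Complex.real_smul]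
  congr 1
  rw [← mul_inv, ← Complex.ofReal_mul, Real.mul_self_sqrt (by positivity)]
  simp

lemma fourierInv_gHat {d : ℕ} (ρ : ℝ → ℝ) (A e : Fin d → ℝ) (m : Fin d → ℕ)
    (x : EuclideanSpace ℝ (Fin d)) :
    𝓕⁻ (gHat d ρ A e m) x = ((Real.sqrt (2 * Real.pi))⁻¹ : ℂ) ^ d *
      ∏ i, brushlet ρ (-(A i)) (A i) (e i) (e i) (m i) (x i) := by
  rw [Real.fourierInv_eq']
  have h1 : ∀ v : EuclideanSpace ℝ (Fin d),
      Complex.exp (↑(2 * Real.pi * inner ℝ v x) * Complex.I) • gHat d ρ A e m v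
      = ∏ i, (Complex.exp (2 * Real.pi * (x i : ℝ) * (v i : ℝ) * Complex.I) *
        ((brushletHat ρ (-(A i)) (A i) (e i) (e i) (m i) (2 * Real.pi * v i) : ℝ) : ℂ)) := by
    intro v
    rw [Finset.prod_mul_distrib, ← Complex.exp_sum, gHat, smul_eq_mul]
    congr 2
    simp only [PiLp.inner_apply, RCLike.inner_apply, conj_trivial]
    push_cast
    rw [Finset.mul_sum, Finset.sum_mul]
    refine Finset.sum_congr rfl fun i _ => by ring
  simp_rw [h1]
  have h2 := (EuclideanSpace.volume_preserving_symm_measurableEquiv_toLp (Fin d)).symm.integral_comp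
    (MeasurableEquiv.measurableEmbedding _)
    (fun v : EuclideanSpace ℝ (Fin d) => ∏ i, (Complex.exp (2 * Real.pi * (x i : ℝ) * (v i : ℝ) * Complex.I) *
        ((brushletHat ρ (-(A i)) (A i) (e i) (e i) (m i) (2 * Real.pi * v i) : ℝ) : ℂ)))
  rw [← h2]
  simp only [MeasurableEquiv.symm_symm, MeasurableEquiv.coe_toLp]
  have h3 := integral_fintype_prod_volume_eq_prod (𝕜 := ℂ) (ι := Fin d) (E := fun _ => ℝ)
    (fun i t => (Complex.exp (2 * Real.pi * (x i : ℝ) * (t : ℝ) * Complex.I) *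
        ((brushletHat ρ (-(A i)) (A i) (e i) (e i) (m i) (2 * Real.pi * t) : ℝ) : ℂ)))
  rw [h3]
  have h4 : ∀ i, _ := fun i => scale_integral
    (fun ξ => ((brushletHat ρ (-(A i)) (A i) (e i) (e i) (m i) ξ : ℝ) : ℂ)) (x i)
  simp_rw [h4, Finset.prod_mul_distrib]
  simp [brushlet]

lemma fourier_brushlet {d : ℕ} {ρ : ℝ → ℝ} (hρsmooth : ∀ m : ℕ, ContDiff ℝ m ρ)
    (hρneg : ∀ ξ, ξ ≤ -1 → ρ ξ = 0) (A e : Fin d → ℝ) (he : ∀ i, 0 < e i) (m : Fin d → ℕ)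
    (w : Lp ℂ 2 (volume : Measure (EuclideanSpace ℝ (Fin d))))
    (hw : (w : EuclideanSpace ℝ (Fin d) → ℂ) =ᵐ[volume]
      fun x => ∏ i, brushlet ρ (-(A i)) (A i) (e i) (e i) (m i) (x i)) :
    (Lp.fourierTransformₗᵢ (EuclideanSpace ℝ (Fin d)) ℂ w : EuclideanSpace ℝ (Fin d) → ℂ)
      =ᵐ[volume] fun η => (Real.sqrt (2 * Real.pi) : ℂ) ^ d * gHat d ρ A e m η := by
  have hcs : HasCompactSupport (gHat d ρ A e m) :=
    hasCompactSupport_of_coord _ _ (gHat_zero hρneg he m)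
  set G : 𝓢(EuclideanSpace ℝ (Fin d), ℂ) :=
    hcs.toSchwartzMap (gHat_contDiff hρsmooth A e m) with hG
  have hGc : (G : EuclideanSpace ℝ (Fin d) → ℂ) = gHat d ρ A e m := rfl
  have hs : (Real.sqrt (2 * Real.pi) : ℂ) ≠ 0 := by
    simp [Real.sqrt_eq_zero', Real.pi_pos.not_ge]
  have key : w = (Real.sqrt (2 * Real.pi) : ℂ) ^ d • (𝓕⁻ G).toLp 2 := by
    apply Lp.ext
    filter_upwards [hw, Lp.coeFn_smul ((Real.sqrt (2 * Real.pi) : ℂ) ^ d) ((𝓕⁻ G).toLp 2),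
      (𝓕⁻ G).coeFn_toLp 2] with x h1 h2 h3
    rw [h1, h2, Pi.smul_apply, h3, SchwartzMap.fourierInv_coe, hGc, fourierInv_gHat, smul_eq_mul,
      ← mul_assoc, ← mul_pow, mul_inv_cancel₀ hs, one_pow, one_mul]
  have h5 : Lp.fourierTransformₗᵢ (EuclideanSpace ℝ (Fin d)) ℂ ((𝓕⁻ G).toLp 2) = G.toLp 2 := by
    rw [← SchwartzMap.toLp_fourierInv_eq]
    exact (Lp.fourierTransformₗᵢ (EuclideanSpace ℝ (Fin d)) ℂ).apply_symm_apply _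
  rw [key, map_smul, h5]
  filter_upwards [Lp.coeFn_smul ((Real.sqrt (2 * Real.pi) : ℂ) ^ d) (G.toLp 2),
      G.coeFn_toLp 2] with x h2 h3
  rw [h2, Pi.smul_apply, h3, hGc, smul_eq_mul]

/-- The angle variable. -/
noncomputable def thet (A x : ℝ) : ℝ := Real.pi * (2 * Real.pi * x + A) / (2 * A)

noncomputable def tFun (d : ℕ) (ρ : ℝ → ℝ) (A e : Fin d → ℝ) (m : Fin d → ℕ)
    (η : EuclideanSpace ℝ (Fin d)) : ℂ :=
  ∏ i, ((bellFn ρ (-(A i)) (A i) (e i) (e i) (2 * Real.pi * η i) *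
    Real.cos (((m i : ℝ) + 1 / 2) * thet (A i) (η i)) : ℝ) : ℂ)

lemma gHat_eq {d : ℕ} (ρ : ℝ → ℝ) (A e : Fin d → ℝ) (m : Fin d → ℕ)
    (η : EuclideanSpace ℝ (Fin d)) :
    gHat d ρ A e m η = (∏ i, ((Real.sqrt (1 / A i) : ℝ) : ℂ)) * tFun d ρ A e m η := by
  rw [gHat, tFun, ← Finset.prod_mul_distrib]
  refine Finset.prod_congr rfl fun i _ => ?_
  rw [← Complex.ofReal_mul, brushletHat, thet]
  congr 1
  rw [mul_assoc]
  refine congrArg₂ _ (congrArg _ ?_) (congrArg₂ _ rfl (congrArg _ ?_))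
  · rw [sub_neg_eq_add, ← two_mul, div_mul_eq_div_div, div_self two_ne_zero]
  · rw [sub_neg_eq_add, sub_neg_eq_add, ← two_mul]; ring

/-- cosines of the angles, as a point of the cube. -/
noncomputable def yMap (d : ℕ) (A : Fin d → ℝ) (η : EuclideanSpace ℝ (Fin d)) :
    Fin d → Set.Icc (-1 : ℝ) 1 :=
  fun i => ⟨Real.cos (thet (A i) (η i)), Real.neg_one_le_cos _, Real.cos_le_one _⟩

/-- coordinate functions on the cube -/
noncomputable def coordF (d : ℕ) (i : Fin d) : C(Fin d → Set.Icc (-1 : ℝ) 1, ℂ) where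
  toFun y := ((y i : ℝ) : ℂ)
  continuous_toFun := by fun_prop

noncomputable def polySub (d : ℕ) : StarSubalgebra ℂ C(Fin d → Set.Icc (-1 : ℝ) 1, ℂ) where
  toSubalgebra := Algebra.adjoin ℂ (Set.range (coordF d))
  star_mem' := by
    change Algebra.adjoin ℂ (Set.range (coordF d)) ≤ star (Algebra.adjoin ℂ (Set.range (coordF d)))
    refine Algebra.adjoin_le ?_
    rintro _ ⟨n, rfl⟩
    refine Algebra.subset_adjoin ⟨n, ?_⟩
    ext1 x
    simp [coordF]

lemma polySub_dense (d : ℕ) : (polySub d).topologicalClosure = ⊤ := by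
  refine ContinuousMap.starSubalgebra_topologicalClosure_eq_top_of_separatesPoints _ ?_
  intro x y hxy
  obtain ⟨i, hi⟩ := Function.ne_iff.1 hxy
  refine ⟨_, ⟨coordF d i, Algebra.subset_adjoin ⟨i, rfl⟩, rfl⟩, ?_⟩
  simpa [coordF, Subtype.ext_iff] using hi

lemma tFun_step {d : ℕ} (ρ : ℝ → ℝ) (A e : Fin d → ℝ) (m : Fin d → ℕ) (i : Fin d) :
    ∃ m₁ m₂ : Fin d → ℕ, ∀ η, tFun d ρ A e m η * ((Real.cos (thet (A i) (η i)) : ℝ) : ℂ)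
      = (1 / 2 : ℂ) * tFun d ρ A e m₁ η + (1 / 2 : ℂ) * tFun d ρ A e m₂ η := by
  refine ⟨Function.update m i (m i + 1), Function.update m i (m i - 1), fun η => ?_⟩
  simp only [tFun]
  rw [← Finset.mul_prod_erase _ _ (Finset.mem_univ i)]
  conv_rhs => rw [← Finset.mul_prod_erase _ _ (Finset.mem_univ i)]
  conv_rhs => 
    enter [2, 2]
    rw [← Finset.mul_prod_erase _ _ (Finset.mem_univ i)]
  have hr : ∀ k : ℕ, (∏ x ∈ Finset.univ.erase i, ((bellFn ρ (-(A x)) (A x) (e x) (e x) (2 * Real.pi * η x) *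
    Real.cos (((Function.update m i k x : ℕ) + 1 / 2 : ℝ) * thet (A x) (η x)) : ℝ) : ℂ)) =
    ∏ x ∈ Finset.univ.erase i, ((bellFn ρ (-(A x)) (A x) (e x) (e x) (2 * Real.pi * η x) *
    Real.cos (((m x : ℕ) + 1 / 2 : ℝ) * thet (A x) (η x)) : ℝ) : ℂ) := by
    intro k
    refine Finset.prod_congr rfl fun x hx => ?_
    rw [Function.update_of_ne (Finset.ne_of_mem_erase hx)]
  rw [hr, hr, Function.update_self, Function.update_self]
  set P := ∏ x ∈ Finset.univ.erase i, ((bellFn ρ (-(A x)) (A x) (e x) (e x) (2 * Real.pi * η x) *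
    Real.cos (((m x : ℕ) + 1 / 2 : ℝ) * thet (A x) (η x)) : ℝ) : ℂ)
  set t := thet (A i) (η i)
  have key : Real.cos (((m i : ℝ) + 1 / 2) * t) * Real.cos t =
      1 / 2 * Real.cos ((((m i + 1 : ℕ) : ℝ) + 1 / 2) * t)
      + 1 / 2 * Real.cos ((((m i - 1 : ℕ) : ℝ) + 1 / 2) * t) := by
    have e1 : (((m i + 1 : ℕ) : ℝ) + 1 / 2) * t = ((m i : ℝ) + 1 / 2) * t + t := by push_cast; ring
    have e2 : Real.cos ((((m i - 1 : ℕ) : ℝ) + 1 / 2) * t) = Real.cos (((m i : ℝ) + 1 / 2) * t - t) := by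
      rcases Nat.eq_zero_or_pos (m i) with h | h
      · rw [h, ← Real.cos_neg]; congr 1; push_cast; ring
      · congr 1; rw [Nat.cast_sub h]; push_cast; ring
    rw [e1, e2, Real.cos_add, Real.cos_sub]; ring
  have key' := congrArg (fun r : ℝ => (r : ℂ)) key
  simp only [Complex.ofReal_mul, Complex.ofReal_add, Complex.ofReal_div, Complex.ofReal_one,
    Complex.ofReal_ofNat] at key' ⊢
  linear_combination (((bellFn ρ (-(A i)) (A i) (e i) (e i) (2 * Real.pi * η i) : ℝ) : ℂ) * P) * key'

section
variable {d : ℕ} {ρ : ℝ → ℝ} {A e : Fin d → ℝ}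
  {V : (Fin d → ℕ) → Lp ℂ 2 (volume : Measure (EuclideanSpace ℝ (Fin d)))} {c : ℂ}

lemma span_step (hA : ∀ i, 0 < A i) (hc : c ≠ 0)
    (hV : ∀ m, (V m : EuclideanSpace ℝ (Fin d) → ℂ) =ᵐ[volume] fun η => c * gHat d ρ A e m η)
    {p : C(Fin d → Set.Icc (-1 : ℝ) 1, ℂ)} (hp : p ∈ polySub d) :
    ∀ m, ∃ q ∈ Submodule.span ℂ (Set.range V), (q : EuclideanSpace ℝ (Fin d) → ℂ) =ᵐ[volume]
      fun η => tFun d ρ A e m η * p (yMap d A η) := by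
  have hp' : p ∈ Submodule.span ℂ (Submonoid.closure (Set.range (coordF d)) : Set _) := by
    rw [← Algebra.adjoin_eq_span]; exact hp
  clear hp
  induction hp' using Submodule.span_induction with
  | mem x h =>
    induction h using Submonoid.closure_induction_left with
    | one =>
      intro m
      set k : ℂ := c * ∏ i, ((Real.sqrt (1 / A i) : ℝ) : ℂ) with hk
      have hk0 : k ≠ 0 := by
        refine mul_ne_zero hc (Finset.prod_ne_zero_iff.2 fun i _ => ?_)
        rw [Complex.ofReal_ne_zero]
        exact (Real.sqrt_pos.2 (one_div_pos.2 (hA i))).ne'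
      refine ⟨k⁻¹ • V m, Submodule.smul_mem _ _ (Submodule.subset_span ⟨m, rfl⟩), ?_⟩
      filter_upwards [Lp.coeFn_smul k⁻¹ (V m), hV m] with η h1 h2
      rw [h1, Pi.smul_apply, h2, gHat_eq, ← mul_assoc, ← hk, smul_eq_mul, inv_mul_cancel_left₀ hk0]
      simp
    | mul_left x hx y hy ih =>
      intro m
      obtain ⟨i, rfl⟩ := hx
      obtain ⟨m₁, m₂, h⟩ := tFun_step ρ A e m i
      obtain ⟨q₁, hq₁, e₁⟩ := ih m₁
      obtain ⟨q₂, hq₂, e₂⟩ := ih m₂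
      refine ⟨(1 / 2 : ℂ) • q₁ + (1 / 2 : ℂ) • q₂,
        Submodule.add_mem _ (Submodule.smul_mem _ _ hq₁) (Submodule.smul_mem _ _ hq₂), ?_⟩
      filter_upwards [Lp.coeFn_add ((1 / 2 : ℂ) • q₁) ((1 / 2 : ℂ) • q₂),
        Lp.coeFn_smul (1 / 2 : ℂ) q₁, Lp.coeFn_smul (1 / 2 : ℂ) q₂, e₁, e₂] with η h1 h2 h3 h4 h5
      rw [h1, Pi.add_apply, h2, h3, Pi.smul_apply, Pi.smul_apply, h4, h5]
      have := h η
      have hco : coordF d i (yMap d A η) = ((Real.cos (thet (A i) (η i)) : ℝ) : ℂ) := rfl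
      rw [ContinuousMap.mul_apply, hco, smul_eq_mul, smul_eq_mul]
      linear_combination (-y (yMap d A η)) * this
  | zero => intro m; exact ⟨0, Submodule.zero_mem _, by
      filter_upwards [Lp.coeFn_zero ℂ 2 (volume : Measure (EuclideanSpace ℝ (Fin d)))] with η h
      rw [h]; simp⟩
  | add x y _ _ hx hy =>
    intro m
    obtain ⟨q₁, hq₁, e₁⟩ := hx m
    obtain ⟨q₂, hq₂, e₂⟩ := hy m
    refine ⟨q₁ + q₂, Submodule.add_mem _ hq₁ hq₂, ?_⟩
    filter_upwards [Lp.coeFn_add q₁ q₂, e₁, e₂] with η h1 h4 h5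
    rw [h1, Pi.add_apply, h4, h5, ContinuousMap.add_apply, mul_add]
  | smul a x _ hx =>
    intro m
    obtain ⟨q₁, hq₁, e₁⟩ := hx m
    refine ⟨a • q₁, Submodule.smul_mem _ _ hq₁, ?_⟩
    filter_upwards [Lp.coeFn_smul a q₁, e₁] with η h1 h4
    rw [h1, Pi.smul_apply, h4, ContinuousMap.smul_apply, smul_eq_mul, smul_eq_mul]; ring

lemma closure_of_cont (hA : ∀ i, 0 < A i) (hc : c ≠ 0)
    (hV : ∀ m, (V m : EuclideanSpace ℝ (Fin d) → ℂ) =ᵐ[volume] fun η => c * gHat d ρ A e m η)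
    (ψ : C(Fin d → Set.Icc (-1 : ℝ) 1, ℂ))
    (g : Lp ℂ 2 (volume : Measure (EuclideanSpace ℝ (Fin d))))
    (hg : (g : EuclideanSpace ℝ (Fin d) → ℂ) =ᵐ[volume]
      fun η => tFun d ρ A e 0 η * ψ (yMap d A η)) :
    g ∈ (Submodule.span ℂ (Set.range V)).topologicalClosure := by
  change g ∈ closure (_ : Set _)
  rw [Metric.mem_closure_iff]
  intro ε hε
  obtain ⟨t, -, ht⟩ := span_step hA hc hV (one_mem (polySub d)) 0
  have hψ : ψ ∈ (polySub d).topologicalClosure := by rw [polySub_dense]; trivial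
  have hψ' : ψ ∈ closure (polySub d : Set C(Fin d → Set.Icc (-1 : ℝ) 1, ℂ)) := hψ
  have hδ : 0 < ε / (‖t‖ + 1) := by positivity
  obtain ⟨p, hp, hd⟩ := Metric.mem_closure_iff.1 hψ' _ hδ
  obtain ⟨q, hq, hqe⟩ := span_step hA hc hV hp 0
  refine ⟨q, hq, ?_⟩
  rw [dist_eq_norm] at hd ⊢
  have : ‖g - q‖ ≤ ‖ψ - p‖ * ‖t‖ := by
    apply Lp.norm_le_mul_norm_of_ae_le_mul
    filter_upwards [Lp.coeFn_sub g q, hg, hqe, ht] with η h1 h2 h3 h4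
    rw [h1, Pi.sub_apply, h2, h3, h4, ← mul_sub, ContinuousMap.one_apply, mul_one, norm_mul, mul_comm]
    gcongr
    exact (ψ - p).norm_coe_le_norm _
  calc ‖g - q‖ ≤ ‖ψ - p‖ * ‖t‖ := this
    _ ≤ ε / (‖t‖ + 1) * ‖t‖ := by gcongr
    _ < ε / (‖t‖ + 1) * (‖t‖ + 1) := by gcongr; linarith
    _ = ε := by field_simp

end

/-- unfold the angle -/
noncomputable def unth (A y : ℝ) : ℝ := (2 * A * Real.arccos y / Real.pi - A) / (2 * Real.pi)

lemma unth_in {A x : ℝ} (hA : 0 < A) (h : |2 * Real.pi * x| ≤ A) :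
    unth A (Real.cos (thet A x)) = x := by
  have := abs_le.1 h
  have hpi := Real.pi_pos
  rw [unth, Real.arccos_cos]
  · rw [thet]; field_simp; ring
  · rw [thet]; apply div_nonneg _ (by positivity); apply mul_nonneg hpi.le; linarith
  · rw [thet, div_le_iff₀ (by positivity)]; apply mul_le_mul_of_nonneg_left _ hpi.le; linarith

lemma unth_out {A x : ℝ} (hA : 0 < A) (h1 : A < |2 * Real.pi * x|)
    (h2 : |2 * Real.pi * x| ≤ 5 / 4 * A) :
    A / 2 < |2 * Real.pi * unth A (Real.cos (thet A x))| := by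
  have h2 := abs_le.1 h2
  have hpi := Real.pi_pos
  have hth : thet A x = Real.pi * ((2 * Real.pi * x + A) / (2 * A)) := by rw [thet, mul_div_assoc]
  set s := (2 * Real.pi * x + A) / (2 * A) with hs
  have hs2 : 2 * A * s = 2 * Real.pi * x + A := by rw [hs]; field_simp
  rcases lt_abs.1 h1 with h1 | h1
  · have : Real.cos (thet A x) = Real.cos (2 * Real.pi - thet A x) := by
      rw [Real.cos_two_pi_sub]
    have hs3 : 1 < s := by by_contra hh; push Not at hh; nlinarith
    have hs4 : s ≤ 9 / 8 := by by_contra hh; push Not at hh; nlinarith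
    rw [this, unth, Real.arccos_cos (by rw [hth]; nlinarith) (by rw [hth]; nlinarith), hth]
    rw [lt_abs]; left
    have : 2 * Real.pi * ((2 * A * (2 * Real.pi - Real.pi * s) / Real.pi - A) / (2 * Real.pi))
      = 2 * A * (2 - s) - A := by field_simp
    rw [this]; nlinarith
  · have : Real.cos (thet A x) = Real.cos (- thet A x) := by
      rw [Real.cos_neg]
    have hs3 : s < 0 := by by_contra hh; push Not at hh; nlinarith
    have hs4 : -1 / 8 ≤ s := by by_contra hh; push Not at hh; nlinarith
    rw [this, unth, Real.arccos_cos (by rw [hth]; nlinarith) (by rw [hth]; nlinarith), hth]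
    rw [lt_abs]; right
    have : -(2 * Real.pi * ((2 * A * (-(Real.pi * s)) / Real.pi - A) / (2 * Real.pi)))
      = 2 * A * s + A := by field_simp; ring
    rw [this]; nlinarith

/-- the safe divisor -/
noncomputable def divF (d : ℕ) (A : Fin d → ℝ) (η : EuclideanSpace ℝ (Fin d)) : ℂ :=
  ∏ i, ((max (Real.cos (1 / 2 * thet (A i) (η i))) (Real.cos (3 / 8 * Real.pi)) : ℝ) : ℂ)

lemma cos38 : 0 < Real.cos (3 / 8 * Real.pi) := by
  apply Real.cos_pos_of_mem_Ioo
  constructor <;> linarith [Real.pi_pos]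

lemma closure_of_supp {d : ℕ} {ρ : ℝ → ℝ} {A e : Fin d → ℝ}
    {V : (Fin d → ℕ) → Lp ℂ 2 (volume : Measure (EuclideanSpace ℝ (Fin d)))} {c : ℂ}
    (hρneg : ∀ ξ, ξ ≤ -1 → ρ ξ = 0) (hρpos : ∀ ξ, 1 ≤ ξ → ρ ξ = 1)
    (hA : ∀ i, 0 < A i) (he : ∀ i, 0 < e i) (heA : ∀ i, e i ≤ A i / 4) (hc : c ≠ 0)
    (hV : ∀ m, (V m : EuclideanSpace ℝ (Fin d) → ℂ) =ᵐ[volume] fun η => c * gHat d ρ A e m η)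
    (g : EuclideanSpace ℝ (Fin d) → ℂ) (hgc : Continuous g)
    (hg0 : ∀ η, (∃ i, A i / 2 < |2 * Real.pi * η i|) → g η = 0)
    (gL : Lp ℂ 2 (volume : Measure (EuclideanSpace ℝ (Fin d))))
    (hgL : (gL : EuclideanSpace ℝ (Fin d) → ℂ) =ᵐ[volume] g) :
    gL ∈ (Submodule.span ℂ (Set.range V)).topologicalClosure := by
  have hdiv0 : ∀ η, divF d A η ≠ 0 := fun η => Finset.prod_ne_zero_iff.2 fun i _ => by
    rw [Complex.ofReal_ne_zero]
    exact (lt_of_lt_of_le cos38 (le_max_right _ _)).ne'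
  have hdivc : Continuous (divF d A) := by
    unfold divF thet
    fun_prop
  let un : (Fin d → Set.Icc (-1 : ℝ) 1) → EuclideanSpace ℝ (Fin d) :=
    fun y => WithLp.toLp 2 fun i => unth (A i) (y i)
  have hun : Continuous un := by
    apply (PiLp.continuous_toLp 2 _).comp
    refine continuous_pi fun i => ?_
    unfold unth
    have := Real.continuous_arccos
    fun_prop
  let ψ : C(Fin d → Set.Icc (-1 : ℝ) 1, ℂ) :=
    ⟨fun y => g (un y) / divF d A (un y),
      ((hgc.comp hun).div (hdivc.comp hun) fun y => hdiv0 _)⟩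
  refine closure_of_cont hA hc hV ψ gL (hgL.trans (Eventually.of_forall fun η => ?_))
  change g η = tFun d ρ A e 0 η * (g (un (yMap d A η)) / divF d A (un (yMap d A η)))
  have hui : ∀ i, un (yMap d A η) i = unth (A i) (Real.cos (thet (A i) (η i))) := fun i => rfl
  by_cases hbig : ∃ i, 5 / 4 * A i < |2 * Real.pi * η i|
  · obtain ⟨i, hi⟩ := hbig
    rw [hg0 η ⟨i, by linarith [hA i]⟩, tFun, Finset.prod_eq_zero (Finset.mem_univ i), zero_mul]
    rw [bell_zero hρneg (he i) (by linarith [heA i])]; simp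
  push Not at hbig
  by_cases hmed : ∃ i, A i < |2 * Real.pi * η i|
  · obtain ⟨i, hi⟩ := hmed
    rw [hg0 η ⟨i, by linarith [hA i]⟩, hg0 (un (yMap d A η)) ⟨i, ?_⟩]
    · simp
    · rw [hui]; exact unth_out (hA i) hi (hbig i)
  push Not at hmed
  have hid : un (yMap d A η) = η := by
    ext i; rw [hui, unth_in (hA i) (hmed i)]
  rw [hid]
  by_cases hsm : ∃ i, A i / 2 < |2 * Real.pi * η i|
  · rw [hg0 η hsm]; simp
  push Not at hsm
  have : tFun d ρ A e 0 η = divF d A η := by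
    refine Finset.prod_congr rfl fun i _ => ?_
    congr 1
    rw [bell_one hρpos (he i) (by linarith [hsm i, heA i, hA i]), one_mul]
    simp only [Pi.zero_apply, Nat.cast_zero, zero_add]
    rw [max_eq_left]
    have h3 := abs_le.1 (hsm i)
    have hA' := hA i
    have hpi := Real.pi_pos
    apply Real.cos_le_cos_of_nonneg_of_le_pi
    · rw [thet]
      refine mul_nonneg (by norm_num) (div_nonneg (mul_nonneg hpi.le ?_) (by positivity)); linarith
    · linarith
    · rw [thet, ← mul_div_assoc, div_le_iff₀ (by positivity)]
      have : Real.pi * (2 * Real.pi * η i + A i) ≤ Real.pi * (3 / 2 * A i) :=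
        mul_le_mul_of_nonneg_left (by linarith) hpi.le
      linarith
  rw [this, mul_div_cancel₀ _ (hdiv0 η)]

lemma two_rpow_tendsto {x : ℝ} (hx : 1 ≤ x) :
    Tendsto (fun N : ℕ => (2 : ℝ) ^ ((N : ℝ) * x)) atTop atTop := by
  refine tendsto_atTop_mono (fun N => ?_) (tendsto_pow_atTop_atTop_of_one_lt (one_lt_two (α := ℝ)))
  rw [← Real.rpow_natCast]
  apply Real.rpow_le_rpow_of_exponent_le one_le_two
  nlinarith [(Nat.cast_nonneg N : (0 : ℝ) ≤ N)]

lemma eps_le {x : ℝ} (hx : 1 ≤ x) (j : ℝ) :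
    (2 : ℝ) ^ ((j - 2) * x) ≤ (2 : ℝ) ^ (j * x) / 4 := by
  have h : (2 : ℝ) ^ ((j - 2) * x) ≤ (2 : ℝ) ^ (j * x - 2) :=
    Real.rpow_le_rpow_of_exponent_le one_le_two (by linarith)
  rw [Real.rpow_sub two_pos] at h
  norm_num at h ⊢
  exact h

lemma exists_fourier {d : ℕ} (a : Fin d → ℝ) {ρ : ℝ → ℝ} (hρsmooth : ∀ m : ℕ, ContDiff ℝ m ρ)
    (hρneg : ∀ ξ, ξ ≤ -1 → ρ ξ = 0)
    (WJL : ℤ → (Fin d → ℕ) → Lp ℂ 2 (volume : Measure (EuclideanSpace ℝ (Fin d))))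
    (hWJL : ∀ j m, (WJL j m : EuclideanSpace ℝ (Fin d) → ℂ)
      =ᵐ[volume] mBrushletBig d ρ a j m) :
    ∃ U : Lp ℂ 2 (volume : Measure (EuclideanSpace ℝ (Fin d))) ≃ₗᵢ[ℂ]
      Lp ℂ 2 (volume : Measure (EuclideanSpace ℝ (Fin d))),
      ∀ (j : ℤ) m, (U (WJL j m) : EuclideanSpace ℝ (Fin d) → ℂ) =ᵐ[volume] fun η =>
      (Real.sqrt (2 * Real.pi) : ℂ) ^ d * gHat d ρ (fun i => (2 : ℝ) ^ ((j : ℝ) * a i))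
        (fun i => (2 : ℝ) ^ (((j : ℝ) - 2) * a i)) m η := by
  refine ⟨Lp.fourierTransformₗᵢ (EuclideanSpace ℝ (Fin d)) ℂ, fun j m => ?_⟩
  refine fourier_brushlet hρsmooth hρneg _ _ (fun i => by positivity) m (WJL j m) ?_
  have h := hWJL j m
  unfold mBrushletBig at h
  exact h

/-- Transfer of closed spans through a unitary map. -/
lemma closure_transfer {H ι : Type*} [NormedAddCommGroup H] [InnerProductSpace ℂ H]
    (U : H ≃ₗᵢ[ℂ] H) (w : ι → H) (x : H)
    (hx : x ∈ (Submodule.span ℂ (Set.range fun m => U (w m))).topologicalClosure) :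
    U.symm x ∈ (Submodule.span ℂ (Set.range w)).topologicalClosure := by
  have hle : (Submodule.span ℂ (Set.range fun m => U (w m))).topologicalClosure ≤
      ((Submodule.span ℂ (Set.range w)).topologicalClosure).comap
        (U.symm.toLinearEquiv : _ →ₗ[ℂ] _) := by
    refine Submodule.topologicalClosure_minimal _ ?_ ?_
    · rw [Submodule.span_le]
      rintro _ ⟨m, rfl⟩
      change U.symm (U (w m)) ∈ (Submodule.span ℂ (Set.range w)).topologicalClosure
      rw [U.symm_apply_apply]
      exact Submodule.le_topologicalClosure _ (Submodule.subset_span ⟨m, rfl⟩)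
    · exact (Submodule.isClosed_topologicalClosure _).preimage U.symm.continuous
  exact hle hx

/-- Let `Q_j` be the orthogonal projection of `L²(ℝ^d;ℂ)` onto `W_j`,
the closed span of the tensor brushlets of the big rectangle at level `j` (characterized
by: `Q_j f ∈ W_j` and `f − Q_j f ⟂ W_j`).  Then for every `f ∈ L²`, `Q_N f → f` and
`Q_{−N} f → 0` in `L²` as `N → ∞`. -/
theorem stmt18 (d : ℕ) (hd : 0 < d) (a : Fin d → ℝ) (ha : ∀ i, 1 ≤ a i)
    (ρ : ℝ → ℝ) (hρsmooth : ∀ m : ℕ, ContDiff ℝ m ρ)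
    (hρ0 : ∀ ξ, 0 ≤ ρ ξ) (hρ1 : ∀ ξ, ρ ξ ≤ 1)
    (hρneg : ∀ ξ, ξ ≤ -1 → ρ ξ = 0) (hρpos : ∀ ξ, 1 ≤ ξ → ρ ξ = 1)
    (hρsq : ∀ ξ, ρ ξ ^ 2 + ρ (-ξ) ^ 2 = 1)
    (WJL : ℤ → (Fin d → ℕ) → Lp ℂ 2 (volume : Measure (EuclideanSpace ℝ (Fin d))))
    (hWJL : ∀ j m, (WJL j m : EuclideanSpace ℝ (Fin d) → ℂ)
      =ᵐ[volume] mBrushletBig d ρ a j m)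
    (Q : ℤ → Lp ℂ 2 (volume : Measure (EuclideanSpace ℝ (Fin d))) →
      Lp ℂ 2 (volume : Measure (EuclideanSpace ℝ (Fin d))))
    (hQmem : ∀ j f, Q j f ∈ (Submodule.span ℂ (Set.range (WJL j))).topologicalClosure)
    (hQorth : ∀ j f, ∀ g ∈ (Submodule.span ℂ (Set.range (WJL j))).topologicalClosure,
      @inner ℂ _ _ (f - Q j f) g = 0) :
    ∀ f : Lp ℂ 2 (volume : Measure (EuclideanSpace ℝ (Fin d))),
      Tendsto (fun N : ℕ => Q (N : ℤ) f) atTop (nhds f) ∧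
      Tendsto (fun N : ℕ => Q (-(N : ℤ)) f) atTop (nhds 0) := by
  intro f
  have hA : ∀ (j : ℤ) i, 0 < (2 : ℝ) ^ ((j : ℝ) * a i) := fun j i => by positivity
  have he : ∀ (j : ℤ) i, 0 < (2 : ℝ) ^ (((j : ℝ) - 2) * a i) := fun j i => by positivity
  have heA : ∀ (j : ℤ) i, (2 : ℝ) ^ (((j : ℝ) - 2) * a i) ≤ (2 : ℝ) ^ ((j : ℝ) * a i) / 4 :=
    fun j i => eps_le (ha i) j
  obtain ⟨c, hc_def⟩ : ∃ c : ℂ, c = (Real.sqrt (2 * Real.pi) : ℂ) ^ d := ⟨_, rfl⟩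
  have hc : c ≠ 0 := by
    rw [hc_def]
    refine pow_ne_zero _ ?_
    simp [Real.sqrt_eq_zero', Real.pi_pos.not_ge]
  obtain ⟨U, hV⟩ := exists_fourier a hρsmooth hρneg WJL hWJL
  rw [← hc_def] at hV
  constructor
  · rw [Metric.tendsto_atTop]
    intro ε hε
    obtain ⟨g, hgs, hgn, hgc, hgm⟩ := (Lp.memLp (U f)).exists_hasCompactSupport_eLpNorm_sub_le
      (by norm_num) (ε := ENNReal.ofReal (ε / 2)) (by simpa using hε)
    obtain ⟨R, hR⟩ := hgs.isCompact.isBounded.subset_closedBall (0 : EuclideanSpace ℝ (Fin d))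
    have hev : ∀ᶠ N : ℕ in atTop, ∀ i, 4 * Real.pi * R < (2 : ℝ) ^ ((N : ℝ) * a i) :=
      eventually_all.2 fun i => (two_rpow_tendsto (ha i)).eventually_gt_atTop _
    obtain ⟨N₀, hN₀⟩ := eventually_atTop.1 hev
    refine ⟨N₀, fun N hN => ?_⟩
    have hclo := closure_of_supp hρneg hρpos (hA N) (he N) (heA N) hc (hV N) g hgc (by
      rintro η ⟨i, hi⟩
      by_contra hne
      have h1 := hR (subset_tsupport g hne)
      rw [mem_closedBall_zero_iff] at h1
      have h2 : |η i| ≤ ‖η‖ := PiLp.norm_apply_le η i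
      have h3 := hN₀ N hN i
      rw [abs_mul, abs_of_pos (by positivity : 0 < 2 * Real.pi)] at hi
      have h4 : 2 * Real.pi * |η i| ≤ 2 * Real.pi * R :=
        mul_le_mul_of_nonneg_left (h2.trans h1) (by positivity)
      simp only [Int.cast_natCast] at hi
      linarith) (hgm.toLp g) hgm.coeFn_toLp
    have hmem : U.symm (hgm.toLp g) ∈
        (Submodule.span ℂ (Set.range (WJL N))).topologicalClosure := by
      exact closure_transfer U (WJL N) _ hclo
    have hdist : ‖f - U.symm (hgm.toLp g)‖ ≤ ε / 2 := by
      rw [← U.norm_map, map_sub, U.apply_symm_apply, Lp.norm_def]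
      refine ENNReal.toReal_le_of_le_ofReal (by positivity) ?_
      refine le_trans (le_of_eq (eLpNorm_congr_ae ?_)) hgn
      filter_upwards [Lp.coeFn_sub (U f) (hgm.toLp g), hgm.coeFn_toLp] with x h1 h2
      rw [h1, Pi.sub_apply, Pi.sub_apply, h2]
    set h := U.symm (hgm.toLp g)
    set D := f - Q N f with hD
    have horth := hQorth N f (h - Q N f) (Submodule.sub_mem _ hmem (hQmem N f))
    have h1 : inner ℂ D D = inner ℂ D (f - h) := by
      have : D = (f - h) + (h - Q N f) := by rw [hD]; abel
      have h0 : inner ℂ D D = inner ℂ D ((f - h) + (h - Q N f)) := congrArg (inner ℂ D) this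
      rw [h0, inner_add_right, horth, add_zero]
    have h2 : ‖D‖ ^ 2 ≤ ‖D‖ * ‖f - h‖ := by
      have := norm_inner_le_norm (𝕜 := ℂ) D (f - h)
      rwa [← h1, inner_self_eq_norm_sq_to_K, norm_pow, RCLike.norm_ofReal, abs_norm] at this
    have h3 : ‖D‖ ≤ ‖f - h‖ := by
      by_contra hh
      push Not at hh
      nlinarith [norm_nonneg (f - h)]
    rw [dist_comm, dist_eq_norm]
    linarith
  · rw [Metric.tendsto_atTop]
    intro ε hε
    obtain ⟨δ, hδ, hδs⟩ := (Lp.memLp (U f)).eLpNorm_indicator_le one_le_two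
      (by norm_num) (half_pos hε)
    obtain ⟨r, hr, hrb⟩ : ∃ r : ℝ, 0 < r ∧
        volume (Metric.closedBall (0 : EuclideanSpace ℝ (Fin d)) r) ≤ ENNReal.ofReal δ := by
      have ht : Tendsto (fun r : ℝ => ENNReal.ofReal (r ^ d) *
          volume (Metric.ball (0 : EuclideanSpace ℝ (Fin d)) 1)) (nhdsWithin 0 (Set.Ioi 0))
          (nhds (ENNReal.ofReal ((0 : ℝ) ^ d) *
          volume (Metric.ball (0 : EuclideanSpace ℝ (Fin d)) 1))) := by
        refine ENNReal.Tendsto.mul_const ?_ (Or.inr measure_ball_lt_top.ne)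
        refine ENNReal.tendsto_ofReal (Tendsto.mono_left ?_ nhdsWithin_le_nhds)
        exact (continuous_pow d).tendsto 0
      rw [zero_pow hd.ne', ENNReal.ofReal_zero, zero_mul] at ht
      have h1 := ht.eventually (eventually_le_nhds (ENNReal.ofReal_pos.2 hδ))
      obtain ⟨r, hr1, hr2⟩ := (h1.and self_mem_nhdsWithin).exists
      refine ⟨r, hr2, ?_⟩
      rw [Measure.addHaar_closedBall _ _ (le_of_lt hr2)]
      simpa using hr1
    have hev : ∀ᶠ N : ℕ in atTop, ∀ i, d / r < (2 : ℝ) ^ ((N : ℝ) * a i) :=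
      eventually_all.2 fun i => (two_rpow_tendsto (ha i)).eventually_gt_atTop _
    obtain ⟨N₀, hN₀⟩ := eventually_atTop.1 hev
    refine ⟨N₀, fun N hN => ?_⟩
    rw [dist_zero_right]
    have hBm : MeasurableSet (Metric.closedBall (0 : EuclideanSpace ℝ (Fin d)) r) :=
      measurableSet_closedBall
    have hkm := (Lp.memLp (U f)).indicator hBm
    set k := hkm.toLp _ with hk
    have hkn : ‖k‖ ≤ ε / 2 := by
      rw [hk, Lp.norm_toLp]
      exact ENNReal.toReal_le_of_le_ofReal (by positivity) (hδs _ hBm hrb)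
    set v := U.symm (U f - k) with hv
    have hperp : (Submodule.span ℂ (Set.range (WJL (-(N : ℤ))))).topologicalClosure ≤
        (Submodule.span ℂ {v})ᗮ := by
      refine Submodule.topologicalClosure_minimal _ ?_ (Submodule.isClosed_orthogonal _)
      rw [Submodule.span_le]
      rintro _ ⟨m, rfl⟩
      rw [SetLike.mem_coe, Submodule.mem_orthogonal_singleton_iff_inner_right,
        ← U.inner_map_map, hv, U.apply_symm_apply, L2.inner_def]
      refine integral_eq_zero_of_ae ?_
      filter_upwards [Lp.coeFn_sub (U f) k, hkm.coeFn_toLp, hV (-(N : ℤ)) m] with η h1 h2 h3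
      rw [h1, Pi.sub_apply, h2, h3]
      by_cases hη : η ∈ Metric.closedBall (0 : EuclideanSpace ℝ (Fin d)) r
      · rw [Set.indicator_of_mem hη]; simp
      · rw [gHat_zero hρneg (he _) m η]
        · simp
        · by_contra hcon
          push Not at hcon
          apply hη
          rw [mem_closedBall_zero_iff]
          have hb : ∀ i, |η i| ≤ r / d := by
            intro i
            refine (hcon i).trans ?_
            have h4 := heA (-(N : ℤ)) i
            have h5 := hA (-(N : ℤ)) i
            have h6 := hN₀ N hN i
            have h7 : (2 : ℝ) ^ (((-(N : ℤ) : ℤ) : ℝ) * a i) < r / d := by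
              have : (((-(N : ℤ) : ℤ) : ℝ) * a i) = -((N : ℝ) * a i) := by push_cast; ring
              rw [this, Real.rpow_neg two_pos.le, ← inv_div]
              have : (0 : ℝ) < d := by exact_mod_cast hd
              exact inv_strictAnti₀ (by positivity) h6
            rw [div_le_iff₀ (by positivity)]
            have : 0 < r / d := h5.trans h7
            nlinarith [Real.pi_gt_three]
          have hsum : ‖η‖ ≤ ∑ i, |η i| := by
            have h8 : ‖η‖ ^ 2 ≤ (∑ i, |η i|) ^ 2 := by
              rw [EuclideanSpace.norm_sq_eq]
              simp only [Real.norm_eq_abs]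
              exact Finset.sum_sq_le_sq_sum_of_nonneg fun i _ => abs_nonneg _
            exact le_of_sq_le_sq h8 (Finset.sum_nonneg fun i _ => abs_nonneg _)
          refine hsum.trans ((Finset.sum_le_sum fun i _ => hb i).trans ?_)
          have : (0 : ℝ) < d := by exact_mod_cast hd
          simp
          field_simp
          exact le_rfl
    set q := Q (-(N : ℤ)) f with hq
    have hvq : inner ℂ v q = 0 :=
      Submodule.mem_orthogonal_singleton_iff_inner_right.1 (hperp (hQmem _ f))
    have hfq : inner ℂ (f - q) q = 0 := hQorth _ f q (hQmem _ f)
    have h1 : inner ℂ q q = inner ℂ (U.symm k) q := by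
      have e1 : v = f - U.symm k := by rw [hv, map_sub, U.symm_apply_apply]
      rw [e1, inner_sub_left, sub_eq_zero] at hvq
      rw [inner_sub_left, sub_eq_zero] at hfq
      rw [← hfq, hvq]
    have h2 : ‖q‖ ^ 2 ≤ ‖k‖ * ‖q‖ := by
      have := norm_inner_le_norm (𝕜 := ℂ) (U.symm k) q
      rwa [← h1, inner_self_eq_norm_sq_to_K, norm_pow, RCLike.norm_ofReal, abs_norm,
        U.symm.norm_map] at this
    by_contra hh
    push Not at hh
    nlinarith [norm_nonneg k]
end
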